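/- arXiv:1805.01997 — 2 statements merged into one kernel-verified Lean document; each statement's English description precedes it below -/
import Mathlib

section
/- Let n ≥ 1, let K be a subset of ℝⁿ that is locally connected in its subspace topology and nowhere flat in ℝⁿ, and let A ⊆ K be an analytic set that is non-meager in the subspace K. Then for every open convex set D ⊆ ℝⁿ containing A and every mid-convex function f : D → ℝ that is bounded above on A (i.e., f(A) is bounded above in ℝ), the function f is continuous on D. -/
/-- A set `K ⊆ ℝⁿ` is nowhere flat if every nonempty relatively open subset of `K`
has affine span equal to all of `ℝⁿ`. -/
def NowhereFlat {n : ℕ} (K : Set (Fin n → ℝ)) : Prop :=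
  ∀ V : Set (Fin n → ℝ), IsOpen V → (V ∩ K).Nonempty → affineSpan ℝ (V ∩ K) = ⊤

open MeasureTheory Set

/-- The projection of `ℝⁿ` onto the torus `ℝⁿ / ℤⁿ`. -/
def torusMk {n : ℕ} (x : Fin n → ℝ) : UnitAddTorus (Fin n) := fun j => (x j : UnitAddCircle)

lemma continuous_torusMk {n : ℕ} : Continuous (torusMk (n := n)) :=
  continuous_pi fun j => (AddCircle.continuous_mk' 1).comp (continuous_apply j)

lemma mFourier_torusMk {n : ℕ} (k : Fin n → ℤ) (x : Fin n → ℝ) :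
    UnitAddTorus.mFourier k (torusMk x) =
      Complex.exp (2 * Real.pi * Complex.I * ∑ j, (k j : ℂ) * (x j : ℂ)) := by
  simp only [UnitAddTorus.mFourier, torusMk, ContinuousMap.coe_mk, fourier_coe_apply]
  rw [← Complex.exp_sum, Finset.mul_sum]
  congr 1
  refine Finset.sum_congr rfl fun j _ => ?_
  simp
  ring

lemma mFourier_torusMk_sum {n : ℕ} (k : Fin n → ℤ) (x : Fin n → Fin n → ℝ) :
    UnitAddTorus.mFourier k (torusMk (∑ i, x i)) =
      ∏ i, UnitAddTorus.mFourier k (torusMk (x i)) := by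
  simp only [mFourier_torusMk]
  rw [← Complex.exp_sum, ← Finset.mul_sum, Finset.sum_comm]
  simp [Finset.mul_sum]

/-- A system of `n` continuously differentiable paths in `ℝⁿ` over `[0, 1]`, the `i`-th having
the `i`-th standard basis vector as its total displacement. -/
structure UnitPaths (n : ℕ) where
  path : Fin n → ℝ → Fin n → ℝ
  vel : Fin n → ℝ → Fin n → ℝ
  hasDerivAt : ∀ i t, HasDerivAt (path i) (vel i t) t
  continuous_vel : ∀ i, Continuous (vel i)
  displacement : ∀ i, path i 1 = path i 0 + Pi.single i 1

namespace UnitPaths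

variable {n : ℕ} (γ : UnitPaths n)

lemma continuous_path (i : Fin n) : Continuous (γ.path i) :=
  continuous_iff_continuousAt.2 fun t => (γ.hasDerivAt i t).continuousAt

/-- The sum of the paths, as a function of the `n` parameters. -/
def sum (t : Fin n → ℝ) : Fin n → ℝ := ∑ i, γ.path i (t i)

/-- The Jacobian determinant of `UnitPaths.sum`. -/
def jac (t : Fin n → ℝ) : ℝ := (Matrix.of fun i j => γ.vel i (t i) j).det

lemma continuous_sum : Continuous γ.sum :=
  continuous_finsetSum _ fun i _ => (γ.continuous_path i).comp (continuous_apply i)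

lemma continuous_jac : Continuous γ.jac := by
  refine Continuous.matrix_det (continuous_matrix fun i j => ?_)
  exact (continuous_apply j).comp ((γ.continuous_vel i).comp (continuous_apply i))

lemma integrableOn (φ : C(UnitAddTorus (Fin n), ℂ)) :
    IntegrableOn (fun t => φ (torusMk (γ.sum t)) * (γ.jac t : ℂ)) (Icc 0 1) := by
  refine ContinuousOn.integrableOn_compact isCompact_Icc (Continuous.continuousOn ?_)
  exact (φ.continuous.comp (continuous_torusMk.comp γ.continuous_sum)).mul
    (Complex.continuous_ofReal.comp γ.continuous_jac)

/-- Integration of a function on the torus pulled back along the sum of the paths. -/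
noncomputable def degree : C(UnitAddTorus (Fin n), ℂ) →L[ℂ] ℂ :=
  LinearMap.mkContinuous
    { toFun := fun φ => ∫ t in Icc 0 1, φ (torusMk (γ.sum t)) * (γ.jac t : ℂ)
      map_add' := fun φ ψ => by
        rw [← integral_add (γ.integrableOn φ) (γ.integrableOn ψ)]
        simp [add_mul]
      map_smul' := fun c φ => by
        simp [mul_assoc, integral_const_mul] }
    (∫ t in Icc (0 : Fin n → ℝ) 1, ‖(γ.jac t : ℂ)‖) fun φ => by
      rw [← integral_mul_const]
      refine norm_integral_le_of_norm_le ?_ (Filter.Eventually.of_forall fun t => ?_)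
      · refine ContinuousOn.integrableOn_compact isCompact_Icc (Continuous.continuousOn ?_)
        exact (Complex.continuous_ofReal.comp γ.continuous_jac).norm.mul continuous_const
      · rw [norm_mul, mul_comm]
        exact mul_le_mul_of_nonneg_left (φ.norm_coe_le_norm _) (norm_nonneg _)

lemma degree_apply (φ : C(UnitAddTorus (Fin n), ℂ)) :
    γ.degree φ = ∫ t in Icc 0 1, φ (torusMk (γ.sum t)) * (γ.jac t : ℂ) := rfl

/-- The integral of the vector valued form `exp (2πi k·x) dx` along the `i`-th path. -/
noncomputable def fourierMatrix (k : Fin n → ℤ) : Matrix (Fin n) (Fin n) ℂ :=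
  Matrix.of fun i j => ∫ s in Icc (0 : ℝ) 1,
    UnitAddTorus.mFourier k (torusMk (γ.path i s)) * (γ.vel i s j : ℂ)

lemma continuous_fourierMatrix_integrand (k : Fin n → ℤ) (i j : Fin n) :
    Continuous fun s => UnitAddTorus.mFourier k (torusMk (γ.path i s)) * (γ.vel i s j : ℂ) :=
  ((UnitAddTorus.mFourier k).continuous.comp (continuous_torusMk.comp (γ.continuous_path i))).mul
    (Complex.continuous_ofReal.comp ((continuous_apply j).comp (γ.continuous_vel i)))

lemma volume_restrict_Icc_pi :
    (volume : Measure (Fin n → ℝ)).restrict (Icc 0 1) =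
      Measure.pi fun _ => (volume : Measure ℝ).restrict (Icc 0 1) := by
  rw [← Measure.restrict_pi_pi, ← volume_pi, pi_univ_Icc]
  rfl

lemma degree_mFourier (k : Fin n → ℤ) :
    γ.degree (UnitAddTorus.mFourier k) = (γ.fourierMatrix k).det := by
  have key : ∀ t : Fin n → ℝ,
      UnitAddTorus.mFourier k (torusMk (γ.sum t)) * (γ.jac t : ℂ) =
      ∑ σ : Equiv.Perm (Fin n), ((Equiv.Perm.sign σ : ℤ) : ℂ) *
        ∏ i, (UnitAddTorus.mFourier k (torusMk (γ.path i (t i))) *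
          (γ.vel i (t i) (σ i) : ℂ)) := by
    intro t
    rw [sum, mFourier_torusMk_sum, jac, ← Matrix.det_transpose, Matrix.det_apply']
    push_cast
    rw [Finset.mul_sum]
    refine Finset.sum_congr rfl fun σ _ => ?_
    rw [Finset.prod_mul_distrib]
    simp only [Matrix.transpose_apply, Matrix.of_apply]
    ring
  rw [degree_apply, ← Matrix.det_transpose, Matrix.det_apply']
  simp only [key]
  rw [volume_restrict_Icc_pi, integral_finsetSum]
  · refine Finset.sum_congr rfl fun σ _ => ?_
    rw [integral_const_mul, integral_fintype_prod_eq_prod (fun i s =>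
      UnitAddTorus.mFourier k (torusMk (γ.path i s)) * (γ.vel i s (σ i) : ℂ))]
    rfl
  · intro σ _
    refine Integrable.const_mul ?_ _
    refine Integrable.fintype_prod (f := fun i s =>
      UnitAddTorus.mFourier k (torusMk (γ.path i s)) * (γ.vel i s (σ i) : ℂ)) fun i => ?_
    exact ContinuousOn.integrableOn_compact isCompact_Icc
      (γ.continuous_fourierMatrix_integrand k i (σ i)).continuousOn

lemma fourierMatrix_mulVec (k : Fin n → ℤ) :
    (γ.fourierMatrix k).mulVec (fun j => (k j : ℂ)) = 0 := by
  ext i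
  set F : ℝ → ℂ := fun s => UnitAddTorus.mFourier k (torusMk (γ.path i s)) with hF
  have hint : ∀ j, IntervalIntegrable (fun s => F s * (γ.vel i s j : ℂ)) volume 0 1 := fun j =>
    (γ.continuous_fourierMatrix_integrand k i j).intervalIntegrable _ _
  have hderiv : ∀ s, HasDerivAt F
      ((2 * Real.pi * Complex.I) * ∑ j, F s * (γ.vel i s j : ℂ) * (k j : ℂ)) s := by
    intro s
    have h1 : HasDerivAt (fun s => 2 * Real.pi * Complex.I *
        ∑ j, (k j : ℂ) * (γ.path i s j : ℂ))
        (2 * Real.pi * Complex.I * ∑ j, (k j : ℂ) * (γ.vel i s j : ℂ)) s := by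
      refine HasDerivAt.const_mul _ (HasDerivAt.fun_sum fun j _ => HasDerivAt.const_mul _ ?_)
      exact (hasDerivAt_pi.1 (γ.hasDerivAt i s) j).ofReal_comp
    have h2 := h1.cexp
    simp only [← mFourier_torusMk] at h2
    convert h2 using 1
    rw [mul_left_comm, Finset.mul_sum _ _ (UnitAddTorus.mFourier k _)]
    congr 1
    exact Finset.sum_congr rfl fun j _ => by simp only [hF]; ring
  have hFTC := intervalIntegral.integral_eq_sub_of_hasDerivAt (a := 0) (b := 1)
    (fun s _ => hderiv s) (Continuous.intervalIntegrable (by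
      refine continuous_const.mul (continuous_finsetSum _ fun j _ => ?_)
      exact (γ.continuous_fourierMatrix_integrand k i j).mul continuous_const) _ _)
  have hend : F 1 - F 0 = 0 := by
    simp only [hF, γ.displacement i, mFourier_torusMk]
    rw [sub_eq_zero, Complex.exp_eq_exp_iff_exists_int]
    refine ⟨k i, ?_⟩
    simp only [Pi.add_apply, Complex.ofReal_add, mul_add, Finset.sum_add_distrib]
    simp [Pi.single_apply, apply_ite (Complex.ofReal)]
    ring
  rw [hend, intervalIntegral.integral_const_mul, intervalIntegral.integral_finsetSum
    (fun j _ => (hint j).mul_const _)] at hFTC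
  have h2 : (2 * Real.pi * Complex.I : ℂ) ≠ 0 := Complex.two_pi_I_ne_zero
  have := (mul_eq_zero.1 hFTC).resolve_left h2
  simp only [Matrix.mulVec, dotProduct, fourierMatrix, Matrix.of_apply, Pi.zero_apply]
  rw [← this]
  refine Finset.sum_congr rfl fun j _ => ?_
  rw [intervalIntegral.integral_mul_const, intervalIntegral.integral_of_le zero_le_one,
    integral_Icc_eq_integral_Ioc]

lemma fourierMatrix_zero : γ.fourierMatrix 0 = 1 := by
  ext i j
  have hFTC := intervalIntegral.integral_eq_sub_of_hasDerivAt (a := 0) (b := 1)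
    (fun s _ => (hasDerivAt_pi.1 (γ.hasDerivAt i s) j).ofReal_comp)
    (Continuous.intervalIntegrable (Complex.continuous_ofReal.comp
      ((continuous_apply j).comp (γ.continuous_vel i))) _ _)
  simp only [fourierMatrix, Matrix.of_apply, UnitAddTorus.mFourier_zero, ContinuousMap.one_apply,
    one_mul]
  rw [integral_Icc_eq_integral_Ioc, ← intervalIntegral.integral_of_le zero_le_one, hFTC,
    γ.displacement i]
  simp [Pi.single_apply, Matrix.one_apply, eq_comm, apply_ite (Complex.ofReal)]

lemma degree_eq (γ' : UnitPaths n) : γ.degree = γ'.degree := by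
  refine ContinuousLinearMap.ext_on (s := range UnitAddTorus.mFourier) ?_ ?_
  · rw [Submodule.dense_iff_topologicalClosure_eq_top]
    exact UnitAddTorus.span_mFourier_closure_eq_top
  · rintro _ ⟨k, rfl⟩
    rw [degree_mFourier, degree_mFourier]
    by_cases hk : k = 0
    · rw [hk, fourierMatrix_zero, fourierMatrix_zero]
    · have hk' : (fun j => (k j : ℂ)) ≠ 0 := fun h =>
        hk (funext fun j => by simpa using congrFun h j)
      rw [Matrix.exists_mulVec_eq_zero_iff.1 ⟨_, hk', γ.fourierMatrix_mulVec k⟩,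
        Matrix.exists_mulVec_eq_zero_iff.1 ⟨_, hk', γ'.fourierMatrix_mulVec k⟩]

/-- Straight paths whose starting points sum to `c`. -/
noncomputable def straight (c : Fin n → ℝ) : UnitPaths n where
  path i t := Pi.single i (c i + t)
  vel i _ := Pi.single i 1
  hasDerivAt i t := by
    rw [hasDerivAt_pi]
    intro j
    rcases eq_or_ne j i with rfl | h
    · simpa using (hasDerivAt_id t).const_add (c j)
    · simpa [h] using hasDerivAt_const t (0 : ℝ)
  continuous_vel i := continuous_const
  displacement i := by simp [← Pi.single_add]

lemma straight_sum (c t : Fin n → ℝ) : (straight c).sum t = c + t := by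
  ext j
  simp [sum, straight, Finset.sum_apply, Pi.single_apply]

lemma straight_jac (c t : Fin n → ℝ) : (straight c).jac t = 1 := by
  have : (Matrix.of fun i j => (straight c).vel i (t i) j) = (1 : Matrix (Fin n) (Fin n) ℝ) := by
    ext i j
    simp [straight, Pi.single_apply, Matrix.one_apply, eq_comm]
  rw [jac, this, Matrix.det_one]

/-- The sum of the paths covers the torus. -/
theorem exists_torusMk_sum_eq (c : Fin n → ℝ) :
    ∃ t ∈ Icc (0 : Fin n → ℝ) 1, torusMk (γ.sum t) = torusMk c := by
  set C : Set (UnitAddTorus (Fin n)) := (fun t => torusMk (γ.sum t)) '' Icc 0 1 with hC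
  have hCc : IsClosed C :=
    (isCompact_Icc.image (continuous_torusMk.comp γ.continuous_sum)).isClosed
  have hCne : C.Nonempty := (nonempty_Icc.2 zero_le_one).image _
  let φ : C(UnitAddTorus (Fin n), ℂ) := ⟨fun x => (Metric.infDist x C : ℂ),
    Complex.continuous_ofReal.comp (Metric.continuous_infDist_pt C)⟩
  have h0 : γ.degree φ = 0 := by
    rw [degree_apply, setIntegral_congr_fun (g := fun _ => (0 : ℂ)) measurableSet_Icc, integral_zero]
    intro t ht
    have : Metric.infDist (torusMk (γ.sum t)) C = 0 :=
      Metric.infDist_zero_of_mem (mem_image_of_mem _ ht)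
    simp [φ, this]
  rw [γ.degree_eq (straight c), degree_apply] at h0
  simp only [straight_sum, straight_jac, φ, ContinuousMap.coe_mk, Complex.ofReal_one, mul_one] at h0
  rw [integral_complex_ofReal, Complex.ofReal_eq_zero] at h0
  have hcont : Continuous fun t : Fin n → ℝ => Metric.infDist (torusMk (c + t)) C :=
    (Metric.continuous_infDist_pt C).comp (continuous_torusMk.comp (continuous_const.add continuous_id))
  rw [integral_eq_zero_iff_of_nonneg (fun _ => Metric.infDist_nonneg)
    (hcont.continuousOn.integrableOn_compact isCompact_Icc)] at h0
  have hsub : Icc (0 : Fin n → ℝ) 1 ⊆ closure (interior (Icc 0 1)) := by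
    rw [← pi_univ_Icc, interior_pi_set finite_univ, closure_pi_set]
    simp
  have h1 := Measure.eqOn_of_ae_eq h0 hcont.continuousOn continuousOn_const hsub
    (left_mem_Icc.2 zero_le_one)
  simp only [add_zero, Pi.zero_apply] at h1
  have h2 := (hCc.mem_iff_infDist_zero hCne).2 h1
  exact h2

end UnitPaths

open scoped Pointwise in
lemma IsPreconnected.thickening_of_normed {E : Type*} [NormedAddCommGroup E] [NormedSpace ℝ E]
    {U : Set E} (hU : IsPreconnected U) (δ : ℝ) : IsPreconnected (Metric.thickening δ U) := by
  rw [← add_ball_zero, ← add_image_prod]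
  exact (hU.prod (convex_ball (0 : E) δ).isPreconnected).image _ continuous_add.continuousOn

open Polynomial in
/-- Two points of a connected set are joined by a polynomial path staying close to the set. -/
lemma IsPreconnected.exists_polynomial_path {n : ℕ} {U : Set (Fin n → ℝ)} (hU : IsPreconnected U)
    {a b : Fin n → ℝ} (ha : a ∈ U) (hb : b ∈ U) {ε : ℝ} (hε : 0 < ε) :
    ∃ p : Fin n → ℝ[X], (∀ j, (p j).eval 0 = a j) ∧ (∀ j, (p j).eval 1 = b j) ∧
      ∀ t ∈ Icc (0 : ℝ) 1, ∃ u ∈ U, dist (fun j => (p j).eval t) u < ε := by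
  have hopen : IsOpen (Metric.thickening (ε / 2) U) := Metric.isOpen_thickening
  have hsub : U ⊆ Metric.thickening (ε / 2) U := Metric.self_subset_thickening (half_pos hε) U
  have hconn : IsConnected (Metric.thickening (ε / 2) U) :=
    ⟨⟨a, hsub ha⟩, hU.thickening_of_normed _⟩
  obtain ⟨g, hg⟩ := (hopen.isConnected_iff_isPathConnected.1 hconn).joinedIn a (hsub ha) b (hsub hb)
  have hη : 0 < ε / 8 := by positivity
  have hq : ∀ j, ∃ q : ℝ[X], ∀ t ∈ Icc (0 : ℝ) 1, |q.eval t - g.extend t j| < ε / 8 := fun j =>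
    exists_polynomial_near_of_continuousOn 0 1 (fun t => g.extend t j)
      ((continuous_apply j).comp g.continuous_extend).continuousOn _ hη
  choose q hq using hq
  refine ⟨fun j => q j + C (a j - (q j).eval 0) * (1 - X) + C (b j - (q j).eval 1) * X,
    fun j => by simp, fun j => by simp, fun t ht => ?_⟩
  obtain ⟨u, hu, hdist⟩ := Metric.mem_thickening_iff.1 (hg ⟨t, ht⟩)
  refine ⟨u, hu, ?_⟩
  have hclose : dist (fun j => (q j + C (a j - (q j).eval 0) * (1 - X) +
      C (b j - (q j).eval 1) * X).eval t) (g ⟨t, ht⟩) ≤ ε / 4 := by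
    refine (dist_pi_le_iff (by positivity)).2 fun j => ?_
    have h0 := hq j 0 (by simp)
    have h1 := hq j 1 (by simp)
    have h2 := hq j t ht
    rw [g.extend_zero] at h0
    rw [g.extend_one] at h1
    rw [g.extend_apply ht] at h2
    simp only [eval_add, eval_mul, eval_C, eval_sub, eval_one, eval_X, Real.dist_eq]
    obtain ⟨h0l, h0r⟩ := abs_lt.1 h0
    obtain ⟨h1l, h1r⟩ := abs_lt.1 h1
    obtain ⟨h2l, h2r⟩ := abs_lt.1 h2
    obtain ⟨ht0, ht1⟩ := ht
    rw [abs_le]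
    constructor <;> nlinarith
  linarith [dist_triangle (fun j => (q j + C (a j - (q j).eval 0) * (1 - X) +
      C (b j - (q j).eval 1) * X).eval t) (g ⟨t, ht⟩) u]

/-- The set of all sums `∑ i, u i` with `u i ∈ U i`. -/
def sumSet {n : ℕ} {E : Type*} [AddCommMonoid E] (U : Fin n → Set E) : Set E :=
  (fun u => ∑ i, u i) '' univ.pi U

lemma exists_mem_sumSet_near {n : ℕ} {U : Fin n → Set (Fin n → ℝ)}
    (hU : ∀ i, IsPreconnected (U i)) {a : Fin n → Fin n → ℝ} (ha : ∀ i, a i ∈ U i)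
    (hb : ∀ i, a i + Pi.single i 1 ∈ U i) (c : Fin n → ℝ) {ε : ℝ} (hε : 0 < ε) :
    ∃ x ∈ sumSet U, ∃ k : Fin n → ℤ, dist (x + fun j => (k j : ℝ)) c < ε := by
  have hδ : 0 < ε / (n + 1) := by positivity
  choose p hp0 hp1 hp using fun i => (hU i).exists_polynomial_path (ha i) (hb i) hδ
  let γ : UnitPaths n :=
    { path := fun i t j => (p i j).eval t
      vel := fun i t j => (p i j).derivative.eval t
      hasDerivAt := fun i t => hasDerivAt_pi.2 fun j => (p i j).hasDerivAt t
      continuous_vel := fun i => continuous_pi fun j => (p i j).derivative.continuous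
      displacement := fun i => by
        ext j
        simp [hp0, hp1] }
  obtain ⟨t, ht, hmk⟩ := γ.exists_torusMk_sum_eq c
  have ht' : ∀ i, t i ∈ Icc (0 : ℝ) 1 := fun i => ⟨ht.1 i, ht.2 i⟩
  choose u hu hdist using fun i => hp i (t i) (ht' i)
  have hk : ∀ j, ∃ k : ℤ, γ.sum t j + k = c j := by
    intro j
    have h := congrFun hmk.symm j
    simp only [torusMk] at h
    rw [← sub_eq_zero, ← AddCircle.coe_sub, AddCircle.coe_eq_zero_iff] at h
    obtain ⟨k, hk⟩ := h
    exact ⟨k, by simp at hk; linarith⟩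
  choose k hk using hk
  refine ⟨∑ i, u i, ⟨u, fun i _ => hu i, rfl⟩, k, ?_⟩
  have hc : c = γ.sum t + fun j => (k j : ℝ) := funext fun j => (hk j).symm
  rw [hc, dist_add_right, dist_comm]
  calc dist (γ.sum t) (∑ i, u i) ≤ ∑ i, dist (γ.path i (t i)) (u i) := dist_sum_sum_le _ _ _
    _ ≤ ∑ _i : Fin n, ε / (n + 1) := Finset.sum_le_sum fun i _ => (hdist i).le
    _ = n * (ε / (n + 1)) := by simp
    _ < ε := by
      rw [mul_div_assoc', div_lt_iff₀ (by positivity)]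
      nlinarith

open scoped Pointwise in
lemma interior_closure_sumSet_nonempty_of_single {n : ℕ} {U : Fin n → Set (Fin n → ℝ)}
    (hU : ∀ i, IsPreconnected (U i)) (hbd : ∀ i, Bornology.IsBounded (U i))
    {a : Fin n → Fin n → ℝ} (ha : ∀ i, a i ∈ U i) (hb : ∀ i, a i + Pi.single i 1 ∈ U i) :
    (interior (closure (sumSet U))).Nonempty := by
  have hcpt : IsCompact (closure (sumSet U)) := by
    have hK : IsCompact ((fun u : Fin n → Fin n → ℝ => ∑ i, u i) ''
        univ.pi fun i => closure (U i)) :=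
      (isCompact_univ_pi fun i => (hbd i).isCompact_closure).image (by fun_prop)
    exact hK.closure_of_subset (image_mono (pi_mono fun i _ => subset_closure))
  set S : Set (Fin n → ℝ) := univ.pi fun _ => range ((↑) : ℤ → ℝ) with hS
  have hSc : IsClosed S := isClosed_set_pi fun _ _ => Int.isClosedEmbedding_coe_real.isClosed_range
  have hclosed : IsClosed (closure (sumSet U) + S) := hSc.add_left_of_isCompact hcpt
  have huniv : closure (sumSet U) + S = univ := by
    rw [← hclosed.closure_eq, ← dense_iff_closure_eq, Metric.dense_iff]
    intro c ε hε
    obtain ⟨x, hx, k, hxk⟩ := exists_mem_sumSet_near hU ha hb c hε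
    exact ⟨_, hxk, add_mem_add (subset_closure hx) fun j _ => mem_range_self _⟩
  have hcover : ⋃ k : Fin n → ℤ, (closure (sumSet U) + {fun j => (k j : ℝ)}) = univ := by
    rw [eq_univ_iff_forall] at huniv ⊢
    intro x
    obtain ⟨y, hy, s, hs, rfl⟩ := huniv x
    choose k hk using fun j => hs j (mem_univ j)
    exact mem_iUnion.2 ⟨k, add_mem_add hy (by simp only [hk]; rfl)⟩
  obtain ⟨k, x, hx⟩ := nonempty_interior_of_iUnion_of_closed
    (fun k => (hcpt.add isCompact_singleton).isClosed) hcover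
  rw [add_singleton, ← Homeomorph.coe_addRight, ← Homeomorph.image_interior] at hx
  exact hx.imp fun _ h => h.1

/-- The sum of `n` bounded connected subsets of `ℝⁿ` with linearly independent displacements
is somewhere dense. -/
theorem interior_closure_sumSet_nonempty {n : ℕ} {U : Fin n → Set (Fin n → ℝ)}
    (hU : ∀ i, IsPreconnected (U i)) (hbd : ∀ i, Bornology.IsBounded (U i))
    {a b : Fin n → Fin n → ℝ} (ha : ∀ i, a i ∈ U i) (hb : ∀ i, b i ∈ U i)
    (hli : LinearIndependent ℝ fun i => b i - a i) :
    (interior (closure (sumSet U))).Nonempty := by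
  let B := basisOfLinearIndependentOfCardEqFinrank' _ hli (by simp)
  let L : (Fin n → ℝ) ≃L[ℝ] (Fin n → ℝ) := B.equivFun.toContinuousLinearEquiv
  have hL : ∀ i, L (b i - a i) = Pi.single i 1 := by
    intro i
    have : B i = b i - a i := by simp [B]
    rw [← this]
    ext j
    simp [L, Pi.single_apply, eq_comm]
  have himage : sumSet (fun i => L '' U i) = L '' sumSet U := by
    ext x
    constructor
    · rintro ⟨u, hu, rfl⟩
      choose v hv hvu using fun i => hu i (mem_univ i)
      exact ⟨_, ⟨v, fun i _ => hv i, rfl⟩, by simp [hvu]⟩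
    · rintro ⟨_, ⟨u, hu, rfl⟩, rfl⟩
      exact ⟨fun i => L (u i), fun i hi => mem_image_of_mem _ (hu i hi), by simp⟩
  have key := interior_closure_sumSet_nonempty_of_single (U := fun i => L '' U i)
    (fun i => (hU i).image _ L.continuous.continuousOn)
    (fun i => L.lipschitz.isBounded_image (hbd i)) (a := fun i => L (a i))
    (fun i => mem_image_of_mem _ (ha i))
    (fun i => ⟨b i, hb i, by rw [← hL i, map_sub]; abel⟩)
  rw [himage, ← L.image_closure, ← L.coe_toHomeomorph, ← Homeomorph.image_interior] at key
  exact (image_nonempty.1 key)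

lemma exists_linearIndependent_of_span_eq_top {E : Type*} [AddCommGroup E] [Module ℝ E]
    [FiniteDimensional ℝ E] {m : ℕ} (hm : m ≤ Module.finrank ℝ E) (D : Fin m → Set E)
    (hD : ∀ i, Submodule.span ℝ (D i) = ⊤) :
    ∃ w : Fin m → E, (∀ i, w i ∈ D i) ∧ LinearIndependent ℝ w := by
  induction m with
  | zero => exact ⟨Fin.elim0, fun i => i.elim0, linearIndependent_empty_type⟩
  | succ m ih =>
    obtain ⟨w, hw, hli⟩ := ih (by omega) (fun i => D i.succ) fun i => hD _
    have hne : Submodule.span ℝ (range w) ≠ ⊤ := by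
      intro h
      have h1 := finrank_range_le_card (R := ℝ) w
      rw [Set.finrank, h, finrank_top, Fintype.card_fin] at h1
      omega
    have hx : ∃ x ∈ D 0, x ∉ Submodule.span ℝ (range w) := by
      by_contra! h
      exact hne (top_le_iff.1 (hD 0 ▸ Submodule.span_le.2 h))
    obtain ⟨x, hx, hxw⟩ := hx
    exact ⟨Fin.cons x w, Fin.cases hx hw, linearIndependent_finCons.2 ⟨hli, hxw⟩⟩

lemma NowhereFlat.exists_isPreconnected_subset {n : ℕ} {K : Set (Fin n → ℝ)} (hnf : NowhereFlat K)
    (hloc : LocallyConnectedSpace K) {O : Set K} (hO : IsOpen O) (hne : O.Nonempty) :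
    ∃ U ⊆ Subtype.val '' O, IsPreconnected U ∧ Bornology.IsBounded U ∧ vectorSpan ℝ U = ⊤ := by
  obtain ⟨x, hx⟩ := hne
  have hmem : O ∩ Subtype.val ⁻¹' Metric.ball (x : Fin n → ℝ) 1 ∈ nhds x :=
    (hO.inter (Metric.isOpen_ball.preimage continuous_subtype_val)).mem_nhds
      ⟨hx, Metric.mem_ball_self one_pos⟩
  obtain ⟨V, hVsub, hVo, hxV, hVc⟩ :=
    locallyConnectedSpace_iff_subsets_isOpen_isConnected.1 hloc x _ hmem
  refine ⟨Subtype.val '' V, image_mono (hVsub.trans inter_subset_left),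
    hVc.isPreconnected.image _ continuous_subtype_val.continuousOn, ?_, ?_⟩
  · refine (Metric.isBounded_ball (x := (x : Fin n → ℝ)) (r := 1)).subset ?_
    rintro _ ⟨y, hy, rfl⟩
    exact (hVsub hy).2
  · obtain ⟨W, hW, rfl⟩ := isOpen_induced_iff.1 hVo
    rw [Subtype.image_preimage_coe, inter_comm]
    exact AffineSubspace.vectorSpan_eq_top_of_affineSpan_eq_top _ _ _
      (hnf W hW ⟨x, hxV, x.2⟩)

/-- If `O i` are nonempty open subsets of a locally connected nowhere flat set, then weighted sums
of elements of the `O i` form a somewhere dense set. -/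
lemma NowhereFlat.interior_closure_image_nonempty {n : ℕ} {K : Set (Fin n → ℝ)}
    (hnf : NowhereFlat K) (hloc : LocallyConnectedSpace K) {O : Fin n → Set K}
    (hO : ∀ i, IsOpen (O i)) (hne : ∀ i, (O i).Nonempty) {c : Fin n → ℝ} (hc : ∀ i, c i ≠ 0) :
    (interior (closure ((fun u : Fin n → Fin n → ℝ => ∑ i, c i • u i) ''
      univ.pi fun i => Subtype.val '' O i))).Nonempty := by
  choose U hUO hUc hUb hUs using fun i => hnf.exists_isPreconnected_subset hloc (hO i) (hne i)
  obtain ⟨w, hw, hli⟩ := exists_linearIndependent_of_span_eq_top (by simp)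
    (fun i => U i -ᵥ U i) hUs
  choose b hb a ha hab using hw
  have hli' : LinearIndependent ℝ fun i => c i • b i - c i • a i := by
    have heq : (fun i => c i • b i - c i • a i) = (fun i => Units.mk0 (c i) (hc i)) • w := by
      ext i : 1
      simp [← hab i, Units.smul_def, smul_sub]
    rw [heq]
    exact hli.units_smul _
  refine (interior_closure_sumSet_nonempty (U := fun i => (c i • ·) '' U i)
    (fun i => (hUc i).image _ (by fun_prop))
    (fun i => (hUb i).smul₀ (c i)) (fun i => mem_image_of_mem _ (ha i))
    (fun i => mem_image_of_mem _ (hb i)) hli').mono (interior_mono (closure_mono ?_))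
  rintro _ ⟨v, hv, rfl⟩
  choose u hu huv using fun i => hv i (mem_univ i)
  exact ⟨u, fun i _ => hUO i (hu i), by simp [← huv]⟩

/-- A continuous map from a second countable space with non-meagre range restricts to a closed set
on which it maps nonempty open sets to non-meagre sets. -/
lemma exists_isClosed_forall_not_isMeagre_image {Z X : Type*} [TopologicalSpace Z]
    [SecondCountableTopology Z] [TopologicalSpace X] (h : Z → X) (hr : ¬ IsMeagre (range h)) :
    ∃ C : Set Z, IsClosed C ∧ C.Nonempty ∧
      ∀ V, IsOpen V → (V ∩ C).Nonempty → ¬ IsMeagre (h '' (V ∩ C)) := by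
  set b := TopologicalSpace.countableBasis Z with hb
  set B : Set (Set Z) := {V ∈ b | IsMeagre (h '' V)} with hB
  have hbad : IsMeagre (h '' ⋃₀ B) := by
    rw [sUnion_eq_biUnion, image_iUnion₂]
    exact isMeagre_biUnion ((TopologicalSpace.countable_countableBasis Z).mono (sep_subset _ _))
      fun V hV => hV.2
  have hopen : IsOpen (⋃₀ B) := isOpen_sUnion fun V hV =>
    TopologicalSpace.isOpen_of_mem_countableBasis hV.1
  refine ⟨(⋃₀ B)ᶜ, hopen.isClosed_compl, ?_, ?_⟩
  · rw [nonempty_compl]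
    intro huniv
    rw [huniv, image_univ] at hbad
    exact hr hbad
  · rintro V hV ⟨x, hxV, hxC⟩ hm
    obtain ⟨W, hWb, hxW, hWV⟩ :=
      (TopologicalSpace.isBasis_countableBasis Z).exists_subset_of_mem_open hxV hV
    refine hxC (mem_sUnion_of_mem hxW ⟨hWb, (hm.union hbad).mono ?_⟩)
    rw [← image_union]
    refine image_mono fun y hy => ?_
    by_cases hyB : y ∈ ⋃₀ B
    · exact Or.inr hyB
    · exact Or.inl ⟨hWV hy, hyB⟩

section Pettis

variable {Y E : Type*} [MetricSpace Y] [NormedAddCommGroup E] {G : Y → E}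

lemma exists_smaller_ball (hG : Continuous G)
    (hcat : ∀ V : Set Y, IsOpen V → V.Nonempty → (interior (closure (G '' V))).Nonempty)
    {x : Y} {r : ℝ} {P : Set E} (hP : IsOpen P)
    (hne : (interior (closure (G '' Metric.ball x r)) ∩ P).Nonempty) {ε : ℝ} (hε : 0 < ε) :
    ∃ x' r', 0 < r' ∧ r' ≤ ε ∧ Metric.closedBall x' r' ⊆ Metric.ball x r ∧
      (interior (closure (G '' Metric.ball x' r')) ∩ P).Nonempty := by
  obtain ⟨z, hz, hzP⟩ := hne
  obtain ⟨_, hvP, v, hv, rfl⟩ := mem_closure_iff.1 (interior_subset hz) P hP hzP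
  have hopen : IsOpen (Metric.ball x r ∩ G ⁻¹' P) := Metric.isOpen_ball.inter (hP.preimage hG)
  obtain ⟨δ, hδ, hsub⟩ := Metric.nhds_basis_closedBall.mem_iff.1 (hopen.mem_nhds ⟨hv, hvP⟩)
  have hr' : 0 < min δ ε := lt_min hδ hε
  have hsub' : Metric.closedBall v (min δ ε) ⊆ Metric.ball x r ∩ G ⁻¹' P :=
    (Metric.closedBall_subset_closedBall (min_le_left _ _)).trans hsub
  refine ⟨v, min δ ε, hr', min_le_right _ _, hsub'.trans inter_subset_left, ?_⟩
  obtain ⟨w, hw⟩ := hcat _ Metric.isOpen_ball (Metric.nonempty_ball.2 hr' : (Metric.ball v _).Nonempty)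
  obtain ⟨_, hw1, y, hy, rfl⟩ := mem_closure_iff.1 (interior_subset hw) _ isOpen_interior hw
  exact ⟨_, hw1, (hsub' (Metric.ball_subset_closedBall hy)).2⟩

/-- The condition that `z` lies in the sum of the interiors of the closures of the `G`-images of two
balls, given by their centers and radii. -/
def SumCondition (G : Y → E) (z : E) (p q : Y × ℝ) : Prop :=
  (interior (closure (G '' Metric.ball p.1 p.2)) ∩
    (fun w => z - w) ⁻¹' interior (closure (G '' Metric.ball q.1 q.2))).Nonempty

lemma SumCondition.exists_smaller (hG : Continuous G)
    (hcat : ∀ V : Set Y, IsOpen V → V.Nonempty → (interior (closure (G '' V))).Nonempty)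
    {z : E} {p q : Y × ℝ} (hp : 0 < p.2) (hq : 0 < q.2) (h : SumCondition G z p q) :
    ∃ p' q' : Y × ℝ, (0 < p'.2 ∧ 0 < q'.2 ∧ SumCondition G z p' q') ∧
      (p'.2 ≤ p.2 / 2 ∧ Metric.closedBall p'.1 p'.2 ⊆ Metric.closedBall p.1 p.2) ∧
      (q'.2 ≤ q.2 / 2 ∧ Metric.closedBall q'.1 q'.2 ⊆ Metric.closedBall q.1 q.2) := by
  have hsubc : Continuous fun w : E => z - w := continuous_const.sub continuous_id
  obtain ⟨x, s, hs, hsr, hxs, w, hw, hw'⟩ := exists_smaller_ball hG hcat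
    (isOpen_interior.preimage hsubc) h (half_pos hp)
  obtain ⟨y, t, ht, htr, hyt, v, hv, hv'⟩ := exists_smaller_ball hG hcat
    (isOpen_interior.preimage hsubc)
    (P := (fun w => z - w) ⁻¹' interior (closure (G '' Metric.ball x s)))
    ⟨z - w, hw', by simpa using hw⟩ (half_pos hq)
  exact ⟨(x, s), (y, t), ⟨hs, ht, z - v, hv', by simpa using hv⟩,
    ⟨hsr, hxs.trans Metric.ball_subset_closedBall⟩,
    ⟨htr, hyt.trans Metric.ball_subset_closedBall⟩⟩

lemma tendsto_radius_zero {r : ℕ → ℝ} (hr : ∀ k, 0 < r k) (hhalf : ∀ k, r (k + 1) ≤ r k / 2) :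
    Filter.Tendsto r Filter.atTop (nhds 0) := by
  refine squeeze_zero (fun k => (hr k).le) (g := fun k => r 0 * (1 / 2) ^ k) (fun k => ?_) ?_
  · induction k with
    | zero => simp
    | succ k ih => rw [pow_succ]; linarith [hhalf k]
  · simpa using (tendsto_pow_atTop_nhds_zero_of_lt_one (r := (1 / 2 : ℝ)) (by norm_num)
      (by norm_num)).const_mul (r 0)

lemma exists_mem_forall_closedBall [CompleteSpace Y] {p : ℕ → Y × ℝ} (hr : ∀ k, 0 < (p k).2)
    (h : ∀ k, (p (k + 1)).2 ≤ (p k).2 / 2 ∧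
      Metric.closedBall (p (k + 1)).1 (p (k + 1)).2 ⊆ Metric.closedBall (p k).1 (p k).2) :
    ∃ x, ∀ k, x ∈ Metric.closedBall (p k).1 (p k).2 := by
  have hanti : Antitone fun k => Metric.closedBall (p k).1 (p k).2 :=
    antitone_nat_of_succ_le fun k => (h k).2
  have hmem : ∀ k m, k ≤ m → (p m).1 ∈ Metric.closedBall (p k).1 (p k).2 := fun k m hkm =>
    hanti hkm (Metric.mem_closedBall_self (hr m).le)
  have hcauchy : CauchySeq fun k => (p k).1 :=
    cauchySeq_of_le_tendsto_0' (fun k => (p k).2)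
      (fun k m hkm => by rw [dist_comm]; exact hmem k m hkm)
      (tendsto_radius_zero hr fun k => (h k).1)
  obtain ⟨x, hx⟩ := cauchySeq_tendsto_of_complete hcauchy
  exact ⟨x, fun k => Metric.isClosed_closedBall.mem_of_tendsto hx
    (Filter.eventually_atTop.2 ⟨k, hmem k⟩)⟩

lemma SumCondition.exists_add_eq [CompleteSpace Y] (hG : Continuous G)
    (hcat : ∀ V : Set Y, IsOpen V → V.Nonempty → (interior (closure (G '' V))).Nonempty)
    {z : E} {p q : Y × ℝ} (hp : 0 < p.2) (hq : 0 < q.2) (h : SumCondition G z p q) :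
    ∃ x y, G x + G y = z := by
  let St := {s : (Y × ℝ) × (Y × ℝ) // 0 < s.1.2 ∧ 0 < s.2.2 ∧ SumCondition G z s.1 s.2}
  have step : ∀ s : St, ∃ s' : St,
      (s'.1.1.2 ≤ s.1.1.2 / 2 ∧
        Metric.closedBall s'.1.1.1 s'.1.1.2 ⊆ Metric.closedBall s.1.1.1 s.1.1.2) ∧
      (s'.1.2.2 ≤ s.1.2.2 / 2 ∧
        Metric.closedBall s'.1.2.1 s'.1.2.2 ⊆ Metric.closedBall s.1.2.1 s.1.2.2) := by
    rintro ⟨⟨p, q⟩, hp, hq, h⟩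
    obtain ⟨p', q', hpq, h1, h2⟩ := h.exists_smaller hG hcat hp hq
    exact ⟨⟨(p', q'), hpq⟩, h1, h2⟩
  choose F hF using step
  let s : ℕ → St := fun k => F^[k] ⟨(p, q), hp, hq, h⟩
  have hs : ∀ k, s (k + 1) = F (s k) := fun k => Function.iterate_succ_apply' _ _ _
  have hr1 : ∀ k, 0 < (s k).1.1.2 := fun k => (s k).2.1
  have hr2 : ∀ k, 0 < (s k).1.2.2 := fun k => (s k).2.2.1
  have hs1 := fun k => (hs k).symm ▸ (hF (s k)).1
  have hs2 := fun k => (hs k).symm ▸ (hF (s k)).2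
  obtain ⟨x, hx⟩ := exists_mem_forall_closedBall (p := fun k => (s k).1.1) hr1 hs1
  obtain ⟨y, hy⟩ := exists_mem_forall_closedBall (p := fun k => (s k).1.2) hr2 hs2
  have approx : ∀ (p : ℕ → Y × ℝ) (x : Y), Filter.Tendsto (fun k => (p k).2) Filter.atTop (nhds 0) →
      (∀ k, x ∈ Metric.closedBall (p k).1 (p k).2) → ∀ δ > 0, ∀ᶠ k in Filter.atTop,
        closure (G '' Metric.ball (p k).1 (p k).2) ⊆ Metric.closedBall (G x) δ := by
    intro p x hp hx δ hδ
    obtain ⟨η, hη, hsub⟩ := Metric.nhds_basis_ball.mem_iff.1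
      (hG.continuousAt.preimage_mem_nhds (Metric.closedBall_mem_nhds (G x) hδ))
    filter_upwards [hp.eventually_lt_const (half_pos hη)] with k hk
    refine closure_minimal ?_ Metric.isClosed_closedBall
    rintro _ ⟨v, hv, rfl⟩
    refine hsub ?_
    have h1 := hx k
    rw [Metric.mem_closedBall] at h1
    rw [Metric.mem_ball] at hv ⊢
    linarith [dist_triangle_right v x (p k).1]
  refine ⟨x, y, eq_of_forall_dist_le fun ε hε => ?_⟩
  obtain ⟨k, hk1, hk2⟩ := ((approx _ x (tendsto_radius_zero hr1 fun k => (hs1 k).1) hx _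
    (half_pos hε)).and (approx _ y (tendsto_radius_zero hr2 fun k => (hs2 k).1) hy _
    (half_pos hε))).exists
  obtain ⟨w, hw1, hw2⟩ := (s k).2.2.2
  have h1 := hk1 (interior_subset hw1)
  have h2 := hk2 (interior_subset hw2)
  rw [Metric.mem_closedBall'] at h1 h2
  calc dist (G x + G y) z = dist (G x + G y) (w + (z - w)) := by rw [add_sub_cancel]
    _ ≤ dist (G x) w + dist (G y) (z - w) := dist_add_add_le _ _ _ _
    _ ≤ ε := by linarith

/-- A Pettis type theorem: if `G` maps nonempty open subsets of a complete space to somewhere dense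
sets, then the set of sums of two values of `G` has nonempty interior. -/
theorem exists_isOpen_forall_exists_add_eq [CompleteSpace Y] [Nonempty Y] (hG : Continuous G)
    (hcat : ∀ V : Set Y, IsOpen V → V.Nonempty → (interior (closure (G '' V))).Nonempty) :
    ∃ W : Set E, IsOpen W ∧ W.Nonempty ∧ ∀ z ∈ W, ∃ x y, G x + G y = z := by
  obtain ⟨x₀⟩ := ‹Nonempty Y›
  obtain ⟨w, hw⟩ := hcat _ Metric.isOpen_ball
    (Metric.nonempty_ball.2 one_pos : (Metric.ball x₀ 1).Nonempty)
  have hcont : Continuous fun z : E => z - w := continuous_id.sub continuous_const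
  refine ⟨_, isOpen_interior.preimage hcont, ⟨w + w, by simpa using hw⟩, fun z hz => ?_⟩
  exact SumCondition.exists_add_eq hG hcat (p := (x₀, 1)) (q := (x₀, 1)) one_pos one_pos
    ⟨w, hw, hz⟩

end Pettis

section MidConvex

variable {E : Type*} [NormedAddCommGroup E] [NormedSpace ℝ E] {D : Set E} {f : E → ℝ}

lemma sum_half_pow_smul_mem {S : Set E} (hS : ∀ x ∈ S, ∀ y ∈ S, (2 : ℝ)⁻¹ • (x + y) ∈ S)
    {a : E} (ha : a ∈ S) {m : ℕ} (x : Fin m → E) (hx : ∀ i, x i ∈ S) :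
    ∑ i : Fin m, (2 : ℝ)⁻¹ ^ ((i : ℕ) + 1) • x i + (2 : ℝ)⁻¹ ^ m • a ∈ S := by
  induction m with
  | zero => simpa using ha
  | succ m ih =>
    convert hS _ (hx 0) _ (ih (fun i => x i.succ) fun i => hx _) using 1
    simp only [Fin.sum_univ_succ, smul_add, Finset.smul_sum, smul_smul, Fin.val_zero, Fin.val_succ,
      pow_succ]
    simp [mul_comm, add_assoc]

lemma midconvex_half_pow_le (hD : Convex ℝ D)
    (hf : ∀ x ∈ D, ∀ y ∈ D, f ((2 : ℝ)⁻¹ • (x + y)) ≤ (f x + f y) / 2) {x z : E} (hx : x ∈ D)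
    (hz : z ∈ D) (k : ℕ) :
    f (z + (2 : ℝ)⁻¹ ^ k • (x - z)) ≤ f z + (2 : ℝ)⁻¹ ^ k * (f x - f z) := by
  induction k with
  | zero => simp
  | succ k ih =>
    have hmem : z + (2 : ℝ)⁻¹ ^ k • (x - z) ∈ D :=
      hD.add_smul_sub_mem hz hx ⟨by positivity, pow_le_one₀ (by norm_num) (by norm_num)⟩
    have h := hf z hz _ hmem
    have heq : (2 : ℝ)⁻¹ • (z + (z + (2 : ℝ)⁻¹ ^ k • (x - z))) =
        z + (2 : ℝ)⁻¹ ^ (k + 1) • (x - z) := by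
      rw [pow_succ]
      module
    rw [heq] at h
    rw [pow_succ] at h ⊢
    linarith

lemma midconvex_exists_ball_le (hDo : IsOpen D) (hD : Convex ℝ D)
    (hf : ∀ x ∈ D, ∀ y ∈ D, f ((2 : ℝ)⁻¹ • (x + y)) ≤ (f x + f y) / 2) {W : Set E} (hW : IsOpen W)
    (hne : W.Nonempty) (hWD : W ⊆ D) {M : ℝ} (hM : ∀ x ∈ W, f x ≤ M) {y : E} (hy : y ∈ D) :
    ∃ r > 0, Metric.ball y r ⊆ D ∧ ∃ C, ∀ x ∈ Metric.ball y r, f x ≤ C := by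
  obtain ⟨x, hx⟩ := hne
  have hlim : Filter.Tendsto (fun k : ℕ => y + ((1 - (2 : ℝ)⁻¹ ^ k)⁻¹ - 1) • (y - x)) Filter.atTop
      (nhds y) := by
    have h1 : Filter.Tendsto (fun k : ℕ => (2 : ℝ)⁻¹ ^ k) Filter.atTop (nhds 0) :=
      tendsto_pow_atTop_nhds_zero_of_lt_one (by norm_num) (by norm_num)
    have h2 := (((h1.const_sub 1).inv₀ (by norm_num)).sub_const 1).smul_const (y - x)
    simpa using h2.const_add y
  obtain ⟨k, hk, hk0⟩ := ((hlim.eventually (hDo.mem_nhds hy)).and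
    (Filter.eventually_gt_atTop 0)).exists
  set z := y + ((1 - (2 : ℝ)⁻¹ ^ k)⁻¹ - 1) • (y - x) with hz
  have hlt : (2 : ℝ)⁻¹ ^ k < 1 := pow_lt_one₀ (by norm_num) (by norm_num) hk0.ne'
  have hpos : (0 : ℝ) < 2⁻¹ ^ k := by positivity
  have hyz : z + (2 : ℝ)⁻¹ ^ k • (x - z) = y := by
    have h1 : 1 - (2 : ℝ)⁻¹ ^ k ≠ 0 := by linarith
    have h2 : (1 - (2 : ℝ)⁻¹ ^ k) * (1 - (2 : ℝ)⁻¹ ^ k)⁻¹ = 1 := mul_inv_cancel₀ h1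
    generalize (1 - (2 : ℝ)⁻¹ ^ k)⁻¹ = t at *
    generalize (2 : ℝ)⁻¹ ^ k = s at *
    have : z + s • (x - z) = ((1 - s) * t) • (y - x) + x := by
      rw [hz]
      module
    rw [this, h2]
    module
  set T : E → E := fun v => x + ((2 : ℝ)⁻¹ ^ k)⁻¹ • (v - y) with hT
  have hTc : Continuous T := by fun_prop
  have hTv : ∀ v, z + (2 : ℝ)⁻¹ ^ k • (T v - z) = v := by
    intro v
    have : z + (2 : ℝ)⁻¹ ^ k • (T v - z) = (z + (2 : ℝ)⁻¹ ^ k • (x - z)) +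
        ((2 : ℝ)⁻¹ ^ k * ((2 : ℝ)⁻¹ ^ k)⁻¹) • (v - y) := by
      simp only [hT]
      module
    rw [this, hyz, mul_inv_cancel₀ hpos.ne']
    module
  have hnhds : D ∩ T ⁻¹' W ∈ nhds y :=
    (hDo.inter (hW.preimage hTc)).mem_nhds ⟨hy, by simpa [hT] using hx⟩
  obtain ⟨r, hr, hsub⟩ := Metric.mem_nhds_iff.1 hnhds
  refine ⟨r, hr, hsub.trans inter_subset_left, f z + (2 : ℝ)⁻¹ ^ k * (M - f z), fun v hv => ?_⟩
  have hTW : T v ∈ W := (hsub hv).2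
  have h := midconvex_half_pow_le hD hf (hWD hTW) hk k
  rw [hTv] at h
  have := mul_le_mul_of_nonneg_left (hM _ hTW) hpos.le
  linarith

/-- The Bernstein–Doetsch theorem. -/
theorem midconvex_continuousOn_of_bddAbove_on_isOpen (hDo : IsOpen D) (hD : Convex ℝ D)
    (hf : ∀ x ∈ D, ∀ y ∈ D, f ((2 : ℝ)⁻¹ • (x + y)) ≤ (f x + f y) / 2) {W : Set E} (hW : IsOpen W)
    (hne : W.Nonempty) (hWD : W ⊆ D) {M : ℝ} (hM : ∀ x ∈ W, f x ≤ M) : ContinuousOn f D := by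
  intro y hy
  refine ContinuousAt.continuousWithinAt ?_
  obtain ⟨r, hr, hrD, C, hC⟩ := midconvex_exists_ball_le hDo hD hf hW hne hWD hM hy
  rw [Metric.continuousAt_iff']
  intro ε hε
  have hlim : Filter.Tendsto (fun k : ℕ => (2 : ℝ)⁻¹ ^ k * (C - f y)) Filter.atTop (nhds 0) := by
    simpa using (tendsto_pow_atTop_nhds_zero_of_lt_one (r := (2 : ℝ)⁻¹) (by norm_num)
      (by norm_num)).mul_const (C - f y)
  obtain ⟨k, hk⟩ := (hlim.eventually_lt_const hε).exists
  have hpos : (0 : ℝ) < 2⁻¹ ^ k := by positivity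
  have hle : (2 : ℝ)⁻¹ ^ k ≤ 1 := pow_le_one₀ (by norm_num) (by norm_num)
  have upper : ∀ h : E, ‖h‖ < 2⁻¹ ^ k * r → f (y + h) - f y < ε := by
    intro h hh
    have hmem : y + ((2 : ℝ)⁻¹ ^ k)⁻¹ • h ∈ Metric.ball y r := by
      rw [mem_ball_iff_norm, add_sub_cancel_left, norm_smul, Real.norm_of_nonneg (by positivity),
        inv_mul_lt_iff₀ hpos]
      exact hh
    have h1 := midconvex_half_pow_le hD hf (hrD hmem) hy k
    rw [add_sub_cancel_left, smul_smul, mul_inv_cancel₀ hpos.ne', one_smul] at h1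
    have := mul_le_mul_of_nonneg_left (hC _ hmem) hpos.le
    linarith
  have hδ : 0 < 2⁻¹ ^ k * r := by positivity
  filter_upwards [Metric.ball_mem_nhds y hδ] with v hv
  have hv' : ‖v - y‖ < 2⁻¹ ^ k * r := mem_ball_iff_norm.1 hv
  have h1 := upper (v - y) hv'
  have h2 := upper (-(v - y)) (by rwa [norm_neg])
  have hnorm : ‖v - y‖ < r := hv'.trans_le (mul_le_of_le_one_left hr.le hle)
  have h3 := hf (y + (v - y)) (hrD (by simpa [dist_eq_norm] using hnorm)) (y + -(v - y))
    (hrD (by simpa [mem_ball_iff_norm, norm_sub_rev] using hnorm))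
  have hmid : (2 : ℝ)⁻¹ • (y + (v - y) + (y + -(v - y))) = y := by module
  rw [hmid] at h3
  rw [add_sub_cancel] at h1 h3
  rw [Real.dist_eq, abs_lt]
  constructor <;> linarith

end MidConvex

/-- If `g` maps nonempty open sets to non-meagre subsets of a locally connected nowhere flat set,
then weighted sums of its values over any nonempty open set are somewhere dense. -/
lemma NowhereFlat.interior_closure_image_sum_nonempty {n : ℕ} {K : Set (Fin n → ℝ)}
    (hnf : NowhereFlat K) (hloc : LocallyConnectedSpace K) {Z : Type*} [TopologicalSpace Z]
    {g : Z → K} (hg : ∀ V, IsOpen V → V.Nonempty → ¬ IsMeagre (g '' V)) {c : Fin n → ℝ}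
    (hc : ∀ i, c i ≠ 0) {V : Set (Fin n → Z)} (hV : IsOpen V) (hne : V.Nonempty) :
    (interior (closure ((fun y : Fin n → Z => ∑ i, c i • (g (y i) : Fin n → ℝ)) '' V))).Nonempty := by
  obtain ⟨y, hy⟩ := hne
  obtain ⟨u, hu, huV⟩ := isOpen_pi_iff'.1 hV y hy
  have hO : ∀ i, (interior (closure (g '' u i))).Nonempty := fun i => by
    by_contra h
    exact hg (u i) (hu i).1 ⟨_, (hu i).2⟩
      (IsNowhereDense.isMeagre (not_nonempty_iff_eq_empty.1 h))
  refine (hnf.interior_closure_image_nonempty hloc (fun i => isOpen_interior) hO hc).mono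
    (interior_mono (closure_minimal ?_ isClosed_closure))
  have hval : ∀ i, Subtype.val '' interior (closure (g '' u i)) ⊆
      closure ((fun z => (g z : Fin n → ℝ)) '' u i) := fun i => by
    refine (image_mono interior_subset).trans ?_
    rw [← image_image Subtype.val g]
    exact image_closure_subset_closure_image continuous_subtype_val
  calc _ ⊆ (fun u : Fin n → Fin n → ℝ => ∑ i, c i • u i) ''
        closure (univ.pi fun i => (fun z => (g z : Fin n → ℝ)) '' u i) := by
        rw [closure_pi_set]
        exact image_mono (pi_mono fun i _ => hval i)
    _ ⊆ closure ((fun u : Fin n → Fin n → ℝ => ∑ i, c i • u i) ''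
        univ.pi fun i => (fun z => (g z : Fin n → ℝ)) '' u i) :=
        image_closure_subset_closure_image (by fun_prop)
    _ ⊆ _ := closure_mono ?_
  rintro _ ⟨v, hv, rfl⟩
  choose z hz hzv using fun i => hv i (mem_univ i)
  exact ⟨z, huV fun i _ => hz i, by simp [← hzv]⟩

theorem midconvex_continuous_of_bddAbove_on_nonmeager_analytic
    {n : ℕ} (hn : 0 < n) (K : Set (Fin n → ℝ))
    (hloc : LocallyConnectedSpace ↥K) (hnf : NowhereFlat K)
    (A : Set (Fin n → ℝ)) (hAK : A ⊆ K)
    (hanal : MeasureTheory.AnalyticSet A)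
    (hA : ¬ IsMeagre ((Subtype.val ⁻¹' A) : Set ↥K))
    (D : Set (Fin n → ℝ)) (hD : IsOpen D) (hDconv : Convex ℝ D) (hAD : A ⊆ D)
    (f : (Fin n → ℝ) → ℝ)
    (hf : ∀ x ∈ D, ∀ y ∈ D, f ((2 : ℝ)⁻¹ • (x + y)) ≤ (f x + f y) / 2)
    (hbdd : BddAbove (f '' A)) :
    ContinuousOn f D := by
  obtain ⟨Z, _, _, g, hg, rfl⟩ := analyticSet_iff_exists_polishSpace_range.1 hanal
  obtain ⟨M, hM⟩ := hbdd
  let h : Z → K := fun z => ⟨g z, hAK (mem_range_self z)⟩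
  have hrange : Subtype.val ⁻¹' range g = range h := by
    ext x
    simp [h, Subtype.ext_iff]
  rw [hrange] at hA
  obtain ⟨C, hC, ⟨a, ha⟩, hCm⟩ := exists_isClosed_forall_not_isMeagre_image h hA
  have : PolishSpace C := hC.polishSpace
  have hhC : ∀ V : Set C, IsOpen V → V.Nonempty → ¬ IsMeagre ((fun z : C => h z) '' V) := by
    rintro V hV ⟨x, hx⟩
    obtain ⟨V', hV', rfl⟩ := isOpen_induced_iff.1 hV
    have := hCm V' hV' ⟨x, hx, x.2⟩
    rwa [← image_image h Subtype.val, Subtype.image_preimage_coe, inter_comm]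
  set c : Fin n → ℝ := fun i => (2 : ℝ)⁻¹ ^ ((i : ℕ) + 1) with hc
  let G : (Fin n → C) → Fin n → ℝ := fun y => ∑ i, c i • g (y i)
  have hG : Continuous G := by fun_prop
  let _ := TopologicalSpace.upgradeIsCompletelyMetrizable (Fin n → C)
  have : Nonempty (Fin n → C) := ⟨fun _ => ⟨a, ha⟩⟩
  obtain ⟨W, hW, ⟨w, hw⟩, hWG⟩ := exists_isOpen_forall_exists_add_eq hG fun V hV hne =>
    hnf.interior_closure_image_sum_nonempty hloc hhC (fun i => by positivity) hV hne
  set S : Set (Fin n → ℝ) := {x ∈ D | f x ≤ M} with hS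
  have hSmid : ∀ x ∈ S, ∀ y ∈ S, (2 : ℝ)⁻¹ • (x + y) ∈ S := by
    rintro x ⟨hxD, hx⟩ y ⟨hyD, hy⟩
    refine ⟨?_, (hf x hxD y hyD).trans (by linarith)⟩
    rw [smul_add]
    exact hDconv hxD hyD (by norm_num) (by norm_num) (by norm_num)
  have hgS : ∀ z, g z ∈ S := fun z =>
    ⟨hAD (mem_range_self z), hM (mem_image_of_mem f (mem_range_self z))⟩
  set b : Fin n → ℝ := (2 : ℝ)⁻¹ ^ n • g a with hb
  have hGS : ∀ y, G y + b ∈ S := fun y =>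
    sum_half_pow_smul_mem hSmid (hgS a) (fun i => g (y i)) fun i => hgS _
  have hsub : (fun x : Fin n → ℝ => (2 : ℝ) • (x - b)) ⁻¹' W ⊆ S := by
    intro x hx
    obtain ⟨y, y', hy⟩ := hWG _ hx
    have := hSmid _ (hGS y) _ (hGS y')
    have heq : (2 : ℝ)⁻¹ • (G y + b + (G y' + b)) = x := by
      have : (2 : ℝ)⁻¹ • (G y + b + (G y' + b)) = (2 : ℝ)⁻¹ • (G y + G y') + b := by module
      rw [this, hy]
      module
    rwa [heq] at this
  refine midconvex_continuousOn_of_bddAbove_on_isOpen hD hDconv hf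
    (hW.preimage (f := fun x : Fin n → ℝ => (2 : ℝ) • (x - b)) (by fun_prop))
    ⟨(2 : ℝ)⁻¹ • w + b, ?_⟩ (hsub.trans fun x hx => hx.1) (M := M) fun x hx => (hsub hx).2
  simpa using hw
end

section
/- Let n ≥ 1, let D ⊆ ℝⁿ be a nonempty open convex set, and let f : D → ℝ be a mid-convex function. Then f is continuous on D if and only if there exists a nonempty compact connected set K ⊆ D whose affine span equals all of ℝⁿ and on which f is bounded above (i.e., f(K) is bounded above in ℝ). -/
open MeasureTheory Set Metric Topology Filter

theorem integrable_of_ae_mem_isCompact {X F : Type*} [TopologicalSpace X] [MeasurableSpace X]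
    [OpensMeasurableSpace X] [TopologicalSpace.PseudoMetrizableSpace X]
    [SecondCountableTopology X] [NormedAddCommGroup F]
    {μ : Measure X} [IsFiniteMeasure μ] {S : Set X} (hS : IsCompact S) (hμ : ∀ᵐ x ∂μ, x ∈ S)
    {f : X → F} (hf : Continuous f) : Integrable f μ := by
  obtain ⟨C, hC⟩ := hS.exists_bound_of_continuousOn hf.continuousOn
  exact Integrable.of_bound hf.aestronglyMeasurable C (hμ.mono hC)

section Flux

variable {E : Type*} [NormedAddCommGroup E] [NormedSpace ℝ E]

theorem ContDiff.continuous_fderiv_apply_prod {φ : E → ℂ} (hφ : ContDiff ℝ 1 φ) :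
    Continuous fun p : E × E => fderiv ℝ φ p.1 p.2 :=
  hφ.continuous_fderiv_apply one_ne_zero

variable [MeasurableSpace E]

/-- A compactly supported finite measure on pairs (position, velocity), with positions in `U`,
along which the integral of the derivative of a function is its increment from `a` to `b`. -/
structure IsFlux (U : Set E) (a b : E) (μ : Measure (E × E)) : Prop where
  isFiniteMeasure : IsFiniteMeasure μ
  exists_isCompact : ∃ S : Set (E × E), IsCompact S ∧ (∀ p ∈ S, p.1 ∈ U) ∧ ∀ᵐ p ∂μ, p ∈ S
  integral_fderiv : ∀ φ : E → ℂ, ContDiff ℝ 1 φ →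
    ∫ p, fderiv ℝ φ p.1 p.2 ∂μ = φ b - φ a

variable [BorelSpace E] [SecondCountableTopology E] {U : Set E} {a b c : E}

theorem IsFlux.add {μ ν : Measure (E × E)} (hμ : IsFlux U a b μ) (hν : IsFlux U b c ν) :
    IsFlux U a c (μ + ν) := by
  obtain ⟨_, ⟨S, hS, hSU, hμS⟩, hμi⟩ := hμ
  obtain ⟨_, ⟨T, hT, hTU, hνT⟩, hνi⟩ := hν
  refine ⟨inferInstance, ⟨S ∪ T, hS.union hT, ?_, ?_⟩, fun φ hφ => ?_⟩
  · rintro p (hp | hp)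
    exacts [hSU p hp, hTU p hp]
  · rw [ae_add_measure_iff]
    exact ⟨hμS.mono fun _ => Or.inl, hνT.mono fun _ => Or.inr⟩
  · have hc := hφ.continuous_fderiv_apply_prod
    rw [integral_add_measure (integrable_of_ae_mem_isCompact hS hμS hc)
      (integrable_of_ae_mem_isCompact hT hνT hc), hμi φ hφ, hνi φ hφ]
    ring

theorem exists_isFlux_of_segment_subset (h : segment ℝ a b ⊆ U) : ∃ μ, IsFlux U a b μ := by
  let ℓ : ℝ → E × E := fun t => (a + t • (b - a), b - a)
  have hℓ : Continuous ℓ := by fun_prop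
  refine ⟨(volume.restrict (Ioc (0 : ℝ) 1)).map ℓ, inferInstance,
    ⟨ℓ '' Icc 0 1, isCompact_Icc.image hℓ, ?_, ?_⟩, fun φ hφ => ?_⟩
  · rintro _ ⟨t, ht, rfl⟩
    apply h
    rw [segment_eq_image']
    exact ⟨t, ht, rfl⟩
  · refine (ae_map_iff hℓ.aemeasurable (isCompact_Icc.image hℓ).measurableSet).2 ?_
    filter_upwards [ae_restrict_mem measurableSet_Ioc] with t ht
    exact mem_image_of_mem _ (Ioc_subset_Icc_self ht)
  · have hc := hφ.continuous_fderiv_apply_prod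
    rw [integral_map hℓ.aemeasurable hc.aestronglyMeasurable,
      ← intervalIntegral.integral_of_le zero_le_one,
      intervalIntegral.integral_eq_sub_of_hasDerivAt (f := fun t : ℝ => φ (a + t • (b - a)))]
    · simp
    · intro t _
      have h1 : HasDerivAt (fun t : ℝ => a + t • (b - a)) (b - a) t := by
        simpa using ((hasDerivAt_id t).smul_const (b - a)).const_add a
      exact (hφ.differentiable one_ne_zero _).hasFDerivAt.comp_hasDerivAt t h1
    · exact (hc.comp hℓ).intervalIntegrable _ _

theorem IsPreconnected.exists_isFlux {K : Set E} (hK : IsPreconnected K) (hU : IsOpen U)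
    (hKU : K ⊆ U) (ha : a ∈ K) (hb : b ∈ K) : ∃ μ, IsFlux U a b μ := by
  refine hK.induction₂' (fun x y => ∃ μ, IsFlux U x y μ) (fun x hx => ?_) ?_ ha hb
  · obtain ⟨r, hr, hrU⟩ := Metric.isOpen_iff.1 hU x (hKU hx)
    filter_upwards [mem_nhdsWithin_of_mem_nhds (ball_mem_nhds x hr)] with y hy
    have hx := mem_ball_self (x := x) hr
    exact ⟨exists_isFlux_of_segment_subset (((convex_ball x r).segment_subset hx hy).trans hrU),
      exists_isFlux_of_segment_subset (((convex_ball x r).segment_subset hy hx).trans hrU)⟩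
  · rintro x y z _ _ _ ⟨μ, hμ⟩ ⟨ν, hν⟩
    exact ⟨_, hμ.add hν⟩

end Flux

theorem integral_fourier_haarAddCircle (k : ℤ) :
    ∫ t : UnitAddCircle, fourier k t ∂AddCircle.haarAddCircle = if k = 0 then 1 else 0 := by
  split_ifs with h
  · simp [h]
  · exact integral_eq_zero_of_add_right_eq_neg (μ := AddCircle.haarAddCircle)
      (fourier_add_half_inv_index h one_pos)

section Torus

variable {ι : Type*} [Fintype ι]

theorem UnitAddTorus.integral_mFourier (k : ι → ℤ) :
    ∫ t, UnitAddTorus.mFourier k t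
      ∂(Measure.pi fun _ : ι => (AddCircle.haarAddCircle : Measure UnitAddCircle)) =
      if k = 0 then 1 else 0 := by
  have h := integral_fintype_prod_eq_prod (fun i (t : UnitAddCircle) => fourier (k i) t)
    (μ := fun _ => AddCircle.haarAddCircle)
  refine h.trans ?_
  simp_rw [integral_fourier_haarAddCircle, Finset.prod_ite_zero, funext_iff]
  simp

/-- The projection from `ι → ℝ` to the torus. -/
def toUnitAddTorus (x : ι → ℝ) : UnitAddTorus ι := fun i => x i

omit [Fintype ι] in
theorem continuous_toUnitAddTorus : Continuous (toUnitAddTorus (ι := ι)) :=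
  continuous_pi fun i => (AddCircle.continuous_mk' 1).comp (continuous_apply i)

theorem mFourier_toUnitAddTorus (k : ι → ℤ) (x : ι → ℝ) :
    UnitAddTorus.mFourier k (toUnitAddTorus x) =
      Complex.exp (2 * Real.pi * Complex.I * ∑ j, (k j : ℂ) * (x j : ℂ)) := by
  simp only [UnitAddTorus.mFourier, ContinuousMap.coe_mk, toUnitAddTorus, fourier_coe_apply,
    ← Complex.exp_sum]
  congr 1
  rw [Finset.mul_sum]
  refine Finset.sum_congr rfl fun j _ => ?_
  push_cast
  ring

theorem mFourier_toUnitAddTorus_sum {κ : Type*} [Fintype κ] (k : ι → ℤ) (x : κ → ι → ℝ) :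
    UnitAddTorus.mFourier k (toUnitAddTorus (∑ i, x i)) =
      ∏ i, UnitAddTorus.mFourier k (toUnitAddTorus (x i)) := by
  simp only [mFourier_toUnitAddTorus, ← Complex.exp_sum, ← Finset.mul_sum, Finset.sum_apply]
  rw [Finset.sum_comm]
  simp only [Complex.ofReal_sum, Finset.mul_sum]

theorem integral_eq_of_integral_mFourier_eq {Ω : Type*} [MeasurableSpace Ω] {ν : Measure Ω}
    {F : Ω → UnitAddTorus ι} (hF : Measurable F) {w : Ω → ℂ} (hw : Integrable w ν)
    (h : ∀ k : ι → ℤ, ∫ ω, UnitAddTorus.mFourier k (F ω) * w ω ∂ν = if k = 0 then 1 else 0)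
    (g : C(UnitAddTorus ι, ℂ)) :
    ∫ ω, g (F ω) * w ω ∂ν =
      ∫ t, g t ∂(Measure.pi fun _ : ι => (AddCircle.haarAddCircle : Measure UnitAddCircle)) := by
  set vol := Measure.pi fun _ : ι => (AddCircle.haarAddCircle : Measure UnitAddCircle)
  have hint : ∀ g : C(UnitAddTorus ι, ℂ), Integrable (fun ω => g (F ω) * w ω) ν := fun g =>
    hw.bdd_mul (c := ‖g‖) (g.continuous.measurable.comp hF).aestronglyMeasurable
      (ae_of_all _ fun ω => g.norm_coe_le_norm _)
  have hint' : ∀ g : C(UnitAddTorus ι, ℂ), Integrable g vol := fun g =>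
    g.continuous.integrable_of_hasCompactSupport (.of_compactSpace g)
  let Λ : C(UnitAddTorus ι, ℂ) →ₗ[ℂ] ℂ :=
    { toFun := fun g => ∫ ω, g (F ω) * w ω ∂ν - ∫ t, g t ∂vol
      map_add' := fun g₁ g₂ => by
        simp only [ContinuousMap.add_apply, add_mul]
        rw [integral_add (hint g₁) (hint g₂), integral_add (hint' g₁) (hint' g₂)]
        ring
      map_smul' := fun c g => by
        simp only [ContinuousMap.smul_apply, smul_eq_mul, mul_assoc, integral_const_mul,
          RingHom.id_apply, mul_sub] }
  let L : C(UnitAddTorus ι, ℂ) →L[ℂ] ℂ := Λ.mkContinuous (∫ ω, ‖w ω‖ ∂ν + 1) fun g => by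
    have h1 : ‖∫ ω, g (F ω) * w ω ∂ν‖ ≤ ∫ ω, ‖g‖ * ‖w ω‖ ∂ν := by
      refine norm_integral_le_of_norm_le (hw.norm.const_mul _) (ae_of_all _ fun ω => ?_)
      rw [norm_mul]
      gcongr
      exact g.norm_coe_le_norm _
    have h2 : ‖∫ t, g t ∂vol‖ ≤ ‖g‖ := by
      simpa using norm_integral_le_of_norm_le_const (μ := vol)
        (ae_of_all _ fun t => g.norm_coe_le_norm t)
    rw [integral_const_mul] at h1
    calc _ ≤ _ := norm_sub_le _ _
      _ ≤ _ := add_le_add h1 h2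
      _ = _ := by ring
  have hL : L = 0 := by
    refine ContinuousLinearMap.ext_on (s := range UnitAddTorus.mFourier) ?_ ?_
    · exact Submodule.dense_iff_topologicalClosure_eq_top.2
        UnitAddTorus.span_mFourier_closure_eq_top
    · rintro _ ⟨k, rfl⟩
      change ∫ ω, UnitAddTorus.mFourier k (F ω) * w ω ∂ν -
        ∫ t, UnitAddTorus.mFourier k t ∂vol = 0
      rw [h k, UnitAddTorus.integral_mFourier, sub_self]
  exact sub_eq_zero.1 (congrArg (fun T : C(UnitAddTorus ι, ℂ) →L[ℂ] ℂ => T g) hL)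

theorem IsFlux.integral_coord {U : Set (ι → ℝ)} {a b : ι → ℝ} {μ : Measure ((ι → ℝ) × (ι → ℝ))}
    (h : IsFlux U a b μ) (j : ι) : ∫ p, (p.2 j : ℂ) ∂μ = b j - a j := by
  let L : (ι → ℝ) →L[ℝ] ℂ := Complex.ofRealCLM.comp (ContinuousLinearMap.proj j)
  have := h.integral_fderiv L L.contDiff
  simpa [L.fderiv, L] using this

theorem IsFlux.integral_mFourier {U : Set (ι → ℝ)} {a b : ι → ℝ}
    {μ : Measure ((ι → ℝ) × (ι → ℝ))} (h : IsFlux U a b μ) (k : ι → ℤ) :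
    ∫ p, UnitAddTorus.mFourier k (toUnitAddTorus p.1) *
        (2 * Real.pi * Complex.I * ∑ j, (k j : ℂ) * (p.2 j : ℂ)) ∂μ =
      UnitAddTorus.mFourier k (toUnitAddTorus b) - UnitAddTorus.mFourier k (toUnitAddTorus a) := by
  let L : (ι → ℝ) →L[ℝ] ℂ := ∑ j, (k j : ℂ) • Complex.ofRealCLM.comp (ContinuousLinearMap.proj j)
  have hL : ∀ x, L x = ∑ j, (k j : ℂ) * (x j : ℂ) := fun x => by
    simp [L]
  simp only [mFourier_toUnitAddTorus, ← hL]
  have hd : ∀ x, HasFDerivAt (fun x => Complex.exp (2 * Real.pi * Complex.I * L x))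
      (Complex.exp (2 * Real.pi * Complex.I * L x) • (2 * Real.pi * Complex.I : ℂ) • L) x :=
    fun x => (L.hasFDerivAt.const_mul (2 * Real.pi * Complex.I : ℂ)).cexp
  have hc : ContDiff ℝ 1 fun x => Complex.exp (2 * Real.pi * Complex.I * L x) :=
    (contDiff_const.mul L.contDiff).cexp
  have := h.integral_fderiv _ hc
  simpa [(hd _).fderiv] using this

variable [DecidableEq ι]

/-- The pushforward to the torus of the determinant of the velocities has the Fourier coefficients
of Haar measure. -/
theorem integral_mFourier_mul_det {U : ι → Set (ι → ℝ)} {a : ι → ι → ℝ}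
    {μ : ι → Measure ((ι → ℝ) × (ι → ℝ))} (h : ∀ i, IsFlux (U i) (a i) (a i + Pi.single i 1) (μ i))
    (k : ι → ℤ) :
    ∫ ω, UnitAddTorus.mFourier k (toUnitAddTorus (∑ i, (ω i).1)) *
      (Matrix.of fun j i => ((ω i).2 j : ℂ)).det ∂(Measure.pi μ) = if k = 0 then 1 else 0 := by
  have hfin : ∀ i, IsFiniteMeasure (μ i) := fun i => (h i).isFiniteMeasure
  have hmF : Continuous fun x : ι → ℝ => UnitAddTorus.mFourier k (toUnitAddTorus x) :=
    (UnitAddTorus.mFourier k).continuous.comp continuous_toUnitAddTorus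
  let V : Matrix ι ι ℂ := .of fun j i =>
    ∫ p, UnitAddTorus.mFourier k (toUnitAddTorus p.1) * (p.2 j : ℂ) ∂(μ i)
  have hint : ∀ i j, Integrable (fun p : (ι → ℝ) × (ι → ℝ) =>
      UnitAddTorus.mFourier k (toUnitAddTorus p.1) * (p.2 j : ℂ)) (μ i) := fun i j => by
    obtain ⟨S, hS, -, hμS⟩ := (h i).exists_isCompact
    refine integrable_of_ae_mem_isCompact hS hμS ?_
    have := hmF.comp (continuous_fst (X := ι → ℝ) (Y := ι → ℝ))
    exact this.mul (by fun_prop)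
  have hdet : ∫ ω, UnitAddTorus.mFourier k (toUnitAddTorus (∑ i, (ω i).1)) *
      (Matrix.of fun j i => ((ω i).2 j : ℂ)).det ∂(Measure.pi μ) = V.det := by
    simp only [Matrix.det_apply', mFourier_toUnitAddTorus_sum, Finset.mul_sum, Matrix.of_apply, V]
    rw [integral_finsetSum]
    · refine Finset.sum_congr rfl fun σ _ => ?_
      rw [← integral_fintype_prod_eq_prod (μ := μ)
        (f := fun i (p : (ι → ℝ) × (ι → ℝ)) =>
          UnitAddTorus.mFourier k (toUnitAddTorus p.1) * (p.2 (σ i) : ℂ)), ← integral_const_mul]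
      refine integral_congr_ae (ae_of_all _ fun ω => ?_)
      simp only [Finset.prod_mul_distrib]
      ring
    · intro σ _
      have := (Integrable.fintype_prod (fun i => hint i (σ i))).const_mul
        ((Equiv.Perm.sign σ : ℤ) : ℂ)
      refine this.congr (ae_of_all _ fun ω => ?_)
      simp only [Finset.prod_mul_distrib]
      ring
  rw [hdet]
  split_ifs with hk
  · have hV : V = 1 := by
      ext j i
      subst hk
      simp [V, UnitAddTorus.mFourier_zero, (h i).integral_coord j, Matrix.one_apply,
        Pi.single_apply, apply_ite Complex.ofReal]
    rw [hV, Matrix.det_one]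
  · refine Matrix.exists_vecMul_eq_zero_iff.1 ⟨fun j => (k j : ℂ), ?_, ?_⟩
    · contrapose! hk
      ext j
      simpa using congrFun hk j
    · ext i
      have h1 := (h i).integral_mFourier k
      have h2 : toUnitAddTorus (a i + Pi.single i 1) = toUnitAddTorus (a i) := by
        ext j
        rcases eq_or_ne j i with rfl | hj
        · simp [toUnitAddTorus]
        · simp [toUnitAddTorus, hj]
      rw [h2, sub_self] at h1
      have h3 : (2 * Real.pi * Complex.I) * ∑ j, (k j : ℂ) * V j i = 0 := by
        rw [← h1]
        simp only [V, Matrix.of_apply, ← integral_const_mul]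
        rw [← integral_finsetSum _ fun j _ => (hint i j).const_mul _, ← integral_const_mul]
        refine integral_congr_ae (ae_of_all _ fun p => ?_)
        simp only [Finset.mul_sum]
        refine Finset.sum_congr rfl fun j _ => by ring
      exact (mul_eq_zero.1 h3).resolve_left Complex.two_pi_I_ne_zero

/-- If each continuum `K i` contains two points differing by the `i`-th unit vector, then the sum of
the `K i` projects onto the torus. -/
theorem exists_sum_mem_toUnitAddTorus_eq {K : ι → Set (ι → ℝ)} (hK : ∀ i, IsCompact (K i))
    (hK' : ∀ i, IsPreconnected (K i)) {a : ι → ι → ℝ} (ha : ∀ i, a i ∈ K i)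
    (ha' : ∀ i, a i + Pi.single i 1 ∈ K i) (z : UnitAddTorus ι) :
    ∃ x : ι → ι → ℝ, (∀ i, x i ∈ K i) ∧ toUnitAddTorus (∑ i, x i) = z := by
  let P : (ι → ι → ℝ) → UnitAddTorus ι := fun x => toUnitAddTorus (∑ i, x i)
  have hP : Continuous P := continuous_toUnitAddTorus.comp (by fun_prop)
  have hpi : IsCompact (univ.pi K) := isCompact_univ_pi hK
  by_contra! hz
  have hzQ : z ∉ P '' univ.pi K := by
    rintro ⟨x, hx, hxz⟩
    exact hz x (fun i => hx i (mem_univ i)) hxz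
  obtain ⟨δ, hδ, hball⟩ := Metric.isOpen_iff.1 (hpi.image hP).isClosed.isOpen_compl z hzQ
  let g : UnitAddTorus ι → ℝ := fun t => max 0 (δ / 2 - dist t z)
  have hg : Continuous g := by fun_prop
  let W : Set (ι → ι → ℝ) := {x | δ / 2 < dist (P x) z}
  have hW : IsOpen W := isOpen_lt continuous_const (hP.dist continuous_const)
  have hKW : univ.pi K ⊆ W := fun x hx => by
    by_contra hxW
    have : dist (P x) z ≤ δ / 2 := not_lt.1 hxW
    exact hball (mem_ball.2 (this.trans_lt (half_lt_self hδ))) (mem_image_of_mem P hx)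
  obtain ⟨ε, hε, hεW⟩ := hpi.exists_thickening_subset_open hW hKW
  choose μ hμ using fun i => (hK' i).exists_isFlux (isOpen_thickening (δ := ε))
    (self_subset_thickening hε _) (ha i) (ha' i)
  have hfin : ∀ i, IsFiniteMeasure (μ i) := fun i => (hμ i).isFiniteMeasure
  have hmem : ∀ᵐ ω ∂(Measure.pi μ), g (P fun i => (ω i).1) = 0 := by
    have : ∀ᵐ ω ∂(Measure.pi μ), ∀ i, (ω i).1 ∈ thickening ε (K i) := by
      rw [ae_all_iff]
      intro i
      obtain ⟨S, -, hSU, hμS⟩ := (hμ i).exists_isCompact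
      exact (Measure.tendsto_eval_ae_ae (μ := μ) (i := i)).eventually (hμS.mono hSU)
    filter_upwards [this] with ω hω
    simp only [mem_thickening_iff] at hω
    choose y hyK hy using hω
    have hWω : (fun i => (ω i).1) ∈ W :=
      hεW (mem_thickening_iff.2 ⟨y, fun i _ => hyK i, (dist_pi_lt_iff hε).2 hy⟩)
    exact max_eq_left (sub_nonpos.2 (le_of_lt hWω))
  have hw : Integrable (fun ω : ι → (ι → ℝ) × (ι → ℝ) =>
      (Matrix.of fun j i => ((ω i).2 j : ℂ)).det) (Measure.pi μ) := by
    choose S hS _ hμS using fun i => (hμ i).exists_isCompact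
    refine integrable_of_ae_mem_isCompact (isCompact_univ_pi hS) (?_ : ∀ᵐ ω ∂_, _) ?_
    · have : ∀ᵐ ω ∂(Measure.pi μ), ∀ i, ω i ∈ S i := ae_all_iff.2 fun i =>
        (Measure.tendsto_eval_ae_ae (μ := μ) (i := i)).eventually (hμS i)
      exact this.mono fun ω hω i _ => hω i
    · refine Continuous.matrix_det (continuous_matrix fun j i => ?_)
      simp only [Matrix.of_apply]
      fun_prop
  have hF : Measurable fun ω : ι → (ι → ℝ) × (ι → ℝ) => toUnitAddTorus (∑ i, (ω i).1) :=
    (continuous_toUnitAddTorus.comp (by fun_prop)).measurable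
  have key := integral_eq_of_integral_mFourier_eq hF hw (integral_mFourier_mul_det hμ)
    ⟨fun t => (g t : ℂ), Complex.continuous_ofReal.comp hg⟩
  rw [integral_eq_zero_of_ae] at key
  · have hpos : 0 < ∫ t, g t
        ∂(Measure.pi fun _ : ι => (AddCircle.haarAddCircle : Measure UnitAddCircle)) :=
      hg.integral_pos_of_hasCompactSupport_nonneg_nonzero (x := z) (.of_compactSpace g)
        (fun t => le_max_left _ _) (by simp [g, hδ])
    simp only [ContinuousMap.coe_mk] at key
    rw [integral_complex_ofReal] at key
    exact hpos.ne (by exact_mod_cast key)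
  · filter_upwards [hmem] with ω hω
    have : g (toUnitAddTorus (∑ i, (ω i).1)) = 0 := hω
    simp [this]

theorem interior_image_sum_nonempty {K : ι → Set (ι → ℝ)} (hK : ∀ i, IsCompact (K i))
    (hK' : ∀ i, IsPreconnected (K i)) {a : ι → ι → ℝ} (ha : ∀ i, a i ∈ K i)
    (ha' : ∀ i, a i + Pi.single i 1 ∈ K i) :
    (interior ((fun x : ι → ι → ℝ => ∑ i, x i) '' univ.pi K)).Nonempty := by
  set S := (fun x : ι → ι → ℝ => ∑ i, x i) '' univ.pi K
  have hS : IsClosed S := ((isCompact_univ_pi hK).image (by fun_prop)).isClosed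
  let τ : (ι → ℤ) → (ι → ℝ) ≃ₜ (ι → ℝ) := fun m => Homeomorph.addRight fun i => (m i : ℝ)
  obtain ⟨m, hm⟩ := nonempty_interior_of_iUnion_of_closed
    (f := fun m => τ m ⁻¹' S) (fun m => hS.preimage (τ m).continuous) <| by
      refine eq_univ_of_forall fun y => mem_iUnion.2 ?_
      obtain ⟨x, hx, hxy⟩ := exists_sum_mem_toUnitAddTorus_eq hK hK' ha ha' (toUnitAddTorus y)
      have : ∀ i, ∃ m : ℤ, (m : ℝ) = (∑ j, x j) i - y i := fun i => by
        have h0 := congrFun hxy i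
        simp only [toUnitAddTorus] at h0
        obtain ⟨m, hm⟩ := (QuotientAddGroup.eq_iff_sub_mem).1 h0
        exact ⟨m, by simpa using hm⟩
      choose m hm using this
      refine ⟨m, x, fun i _ => hx i, ?_⟩
      ext i
      simp [τ, hm]
  rw [← (τ m).preimage_interior] at hm
  exact hm.imp' (τ m) fun _ => id

/-- If each continuum `K i` contains two points differing by the `i`-th vector of a basis, then the
sum of the `K i` has nonempty interior. -/
theorem interior_image_sum_nonempty_of_basis (b : Module.Basis ι ℝ (ι → ℝ))
    {K : ι → Set (ι → ℝ)} (hK : ∀ i, IsCompact (K i)) (hK' : ∀ i, IsPreconnected (K i))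
    {a : ι → ι → ℝ} (ha : ∀ i, a i ∈ K i) (ha' : ∀ i, a i + b i ∈ K i) :
    (interior ((fun x : ι → ι → ℝ => ∑ i, x i) '' univ.pi K)).Nonempty := by
  let e : (ι → ℝ) ≃L[ℝ] (ι → ℝ) := b.equivFunL
  have h := interior_image_sum_nonempty (K := fun i => e '' K i) (a := fun i => e (a i))
    (fun i => (hK i).image e.continuous) (fun i => (hK' i).image e e.continuous.continuousOn)
    (fun i => mem_image_of_mem e (ha i)) (fun i => ⟨_, ha' i, by
      rw [map_add]
      congr 1
      ext j
      simp [e, Pi.single_apply, Finsupp.single_apply, eq_comm]⟩)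
  have himage : (fun x : ι → ι → ℝ => ∑ i, x i) '' univ.pi (fun i => e '' K i) =
      e '' ((fun x : ι → ι → ℝ => ∑ i, x i) '' univ.pi K) := by
    ext y
    constructor
    · rintro ⟨x, hx, rfl⟩
      choose w hw hwx using fun i => hx i (mem_univ i)
      exact ⟨_, ⟨w, fun i _ => hw i, rfl⟩, by simp [hwx]⟩
    · rintro ⟨_, ⟨x, hx, rfl⟩, rfl⟩
      exact ⟨fun i => e (x i), fun i hi => mem_image_of_mem e (hx i hi), by simp⟩
  rw [himage, ← ContinuousLinearEquiv.coe_toHomeomorph, ← Homeomorph.image_interior] at h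
  exact h.of_image

theorem sum_two_inv_pow_smul_add_mem {E : Type*} [AddCommGroup E] [Module ℝ E] {B : Set E}
    (hB : ∀ x ∈ B, ∀ y ∈ B, (2 : ℝ)⁻¹ • (x + y) ∈ B) {a : E} (ha : a ∈ B) {n : ℕ}
    (y : Fin n → E) (hy : ∀ i, y i ∈ B) :
    ∑ i : Fin n, (2 : ℝ)⁻¹ ^ (i + 1 : ℕ) • y i + (2 : ℝ)⁻¹ ^ n • a ∈ B := by
  induction n with
  | zero => simpa using ha
  | succ n ih =>
    convert hB _ (hy 0) _ (ih (fun i => y i.succ) fun i => hy i.succ) using 1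
    rw [Fin.sum_univ_succ]
    simp only [smul_add, Finset.smul_sum, smul_smul, Fin.val_zero, Fin.val_succ, zero_add, pow_one,
      ← pow_succ', add_assoc]

theorem exists_basis_vadd_mem_of_affineSpan_eq_top {n : ℕ} {K : Set (Fin n → ℝ)}
    (hK : affineSpan ℝ K = ⊤) {a : Fin n → ℝ} (ha : a ∈ K) :
    ∃ b : Module.Basis (Fin n) ℝ (Fin n → ℝ), ∀ i, a + b i ∈ K := by
  have hspan : Submodule.span ℝ ((· -ᵥ a) '' K) = ⊤ := by
    rw [← vectorSpan_eq_span_vsub_set_right ℝ ha, ← direction_affineSpan, hK,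
      AffineSubspace.direction_top]
  obtain ⟨v, hvK, hv, hli⟩ := Submodule.exists_fun_fin_finrank_span_eq ℝ ((· -ᵥ a) '' K)
  have hrank : Module.finrank ℝ (Submodule.span ℝ ((· -ᵥ a) '' K)) = n := by
    rw [hspan, finrank_top, Module.finrank_fin_fun]
  refine ⟨(Module.Basis.mk hli (by rw [hv, hspan])).reindex (finCongr hrank), fun i => ?_⟩
  obtain ⟨x, hx, hxv⟩ := hvK ((finCongr hrank).symm i)
  rw [Module.Basis.reindex_apply, Module.Basis.mk_apply, ← hxv]
  simpa using hx

/-- A midpoint-closed set containing a non-flat continuum contains a nonempty open set. -/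
theorem exists_isOpen_subset_of_midpoint_mem {n : ℕ} {K B : Set (Fin n → ℝ)}
    (hK : IsCompact K) (hK' : IsConnected K) (hspan : affineSpan ℝ K = ⊤) (hKB : K ⊆ B)
    (hB : ∀ x ∈ B, ∀ y ∈ B, (2 : ℝ)⁻¹ • (x + y) ∈ B) :
    ∃ U ⊆ B, IsOpen U ∧ U.Nonempty := by
  obtain ⟨a, ha⟩ := hK'.nonempty
  obtain ⟨b, hb⟩ := exists_basis_vadd_mem_of_affineSpan_eq_top hspan ha
  let c : Fin n → ℝ := fun i => (2 : ℝ)⁻¹ ^ (i + 1 : ℕ)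
  have hc : ∀ i, IsUnit (c i) := fun i => (isUnit_iff_ne_zero.2 (by positivity))
  have h := interior_image_sum_nonempty_of_basis (b.isUnitSMul hc)
    (K := fun i => (c i • ·) '' K) (a := fun i => c i • a)
    (fun i => hK.image (continuous_const_smul _))
    (fun i => hK'.isPreconnected.image _ (continuous_const_smul _).continuousOn)
    (fun i => ⟨a, ha, rfl⟩) (fun i => ⟨_, hb i, by simp [Module.Basis.isUnitSMul_apply]⟩)
  let τ := Homeomorph.addRight ((2 : ℝ)⁻¹ ^ n • a)
  refine ⟨τ '' interior _, ?_, τ.isOpenMap _ isOpen_interior, h.image τ⟩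
  rintro _ ⟨z, hz, rfl⟩
  obtain ⟨x, hx, rfl⟩ := interior_subset hz
  choose y hy hyx using fun i => hx i (mem_univ i)
  have := sum_two_inv_pow_smul_add_mem hB (hKB ha) y fun i => hKB (hy i)
  simpa [τ, ← hyx, c] using this

end Torus

/-- A mid-convex function bounded above on a nonempty open set is locally bounded above. -/
theorem exists_eventually_le_of_midconvex {E : Type*} [NormedAddCommGroup E] [NormedSpace ℝ E]
    {D U : Set E} {f : E → ℝ} (hD : IsOpen D) (hDconv : Convex ℝ D)
    (hf : ∀ x ∈ D, ∀ y ∈ D, f ((2 : ℝ)⁻¹ • (x + y)) ≤ (f x + f y) / 2)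
    (hU : IsOpen U) (hUne : U.Nonempty) (hUD : U ⊆ D) (hbdd : BddAbove (f '' U))
    {y : E} (hy : y ∈ D) : ∃ M, ∀ᶠ x in 𝓝 y, f x ≤ M := by
  let G : Set E := {x | ∃ M, ∀ᶠ z in 𝓝 x, f z ≤ M}
  have hG : IsOpen G := by
    rw [isOpen_iff_mem_nhds]
    rintro x ⟨M, hM⟩
    filter_upwards [hM.eventually_nhds] with z hz using ⟨M, hz⟩
  have hUG : U ⊆ G := by
    intro x hx
    obtain ⟨M, hM⟩ := hbdd
    refine ⟨M, ?_⟩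
    filter_upwards [hU.mem_nhds hx] with z hz using hM (mem_image_of_mem f hz)
  obtain ⟨u, hu⟩ := hUne
  refine hDconv.isPreconnected.subset_of_closure_inter_subset hG ⟨u, hUD hu, hUG hu⟩ ?_ hy
  rintro x ⟨hxG, hxD⟩
  have hcont : ContinuousAt (fun w : E => (2 : ℝ) • x - w) x := by fun_prop
  have hev : ∀ᶠ w in 𝓝 x, w ∈ D ∧ (2 : ℝ) • x - w ∈ D := by
    have hxD' : (2 : ℝ) • x - x ∈ D := by simpa [two_smul] using hxD
    exact Filter.Eventually.and (hD.mem_nhds hxD) (hcont.eventually_mem (hD.mem_nhds hxD'))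
  obtain ⟨w, hwG, hwD, hwD'⟩ := (mem_closure_iff_frequently.1 hxG).and_eventually hev |>.exists
  obtain ⟨M, hM⟩ := hwG
  refine ⟨(M + f ((2 : ℝ) • x - w)) / 2, ?_⟩
  have hcont' : ContinuousAt (fun z : E => (2 : ℝ) • z - ((2 : ℝ) • x - w)) x := by fun_prop
  have hlim : Tendsto (fun z : E => (2 : ℝ) • z - ((2 : ℝ) • x - w)) (𝓝 x) (𝓝 w) := by
    simpa [ContinuousAt] using hcont'
  filter_upwards [hlim.eventually hM, hlim.eventually (hD.mem_nhds hwD)] with z hz hzD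
  have := hf _ hzD _ hwD'
  rw [sub_add_cancel, inv_smul_smul₀ two_ne_zero] at this
  linarith

/-- A mid-convex function is continuous at every point near which it is bounded above. -/
theorem continuousAt_of_midconvex_of_bddAbove {E : Type*} [NormedAddCommGroup E] [NormedSpace ℝ E]
    {D : Set E} {f : E → ℝ} (hD : IsOpen D)
    (hf : ∀ x ∈ D, ∀ y ∈ D, f ((2 : ℝ)⁻¹ • (x + y)) ≤ (f x + f y) / 2)
    {y : E} (hy : y ∈ D) {M : ℝ} (hM : ∀ᶠ x in 𝓝 y, f x ≤ M) : ContinuousAt f y := by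
  obtain ⟨r, hr, hball⟩ := Metric.eventually_nhds_iff_ball.1 (hM.and (hD.mem_nhds hy))
  have hmem : ∀ h : E, ‖h‖ < r → y + h ∈ ball y r := fun h hh => by simpa using hh
  have upper : ∀ m : ℕ, ∀ h : E, ‖h‖ < r / 2 ^ m → f (y + h) - f y ≤ (M - f y) / 2 ^ m := by
    intro m
    induction m with
    | zero =>
      intro h hh
      simpa using (hball _ (hmem h (by simpa using hh))).1
    | succ m ih =>
      intro h hh
      have h2 : ‖(2 : ℝ) • h‖ < r / 2 ^ m := by
        rw [norm_smul, Real.norm_two]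
        rw [pow_succ, ← div_div] at hh
        linarith
      have hr' : r / 2 ^ m ≤ r := div_le_self hr.le (one_le_pow₀ one_le_two)
      have := hf y hy _ (hball _ (hmem _ (h2.trans_le hr'))).2
      rw [← add_assoc, ← two_smul ℝ y, ← smul_add, inv_smul_smul₀ two_ne_zero] at this
      have h3 := ih _ h2
      rw [pow_succ, ← div_div]
      linarith
  rw [Metric.continuousAt_iff]
  intro ε hε
  have hlim : Tendsto (fun m : ℕ => (M - f y) / 2 ^ m) atTop (𝓝 0) :=
    tendsto_const_nhds.div_atTop (tendsto_pow_atTop_atTop_of_one_lt one_lt_two)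
  obtain ⟨m, hm⟩ := (hlim.eventually (gt_mem_nhds hε)).exists
  refine ⟨r / 2 ^ m, by positivity, fun {x} hx => ?_⟩
  rw [dist_eq_norm] at hx
  have hr' : r / 2 ^ m ≤ r := div_le_self hr.le (one_le_pow₀ one_le_two)
  have h1 := upper m (x - y) hx
  have h2 := upper m (-(x - y)) (by rwa [norm_neg])
  have h3 := hf _ (hball _ (hmem (x - y) (hx.trans_le hr'))).2 _
    (hball _ (hmem (-(x - y)) (by rw [norm_neg]; exact hx.trans_le hr'))).2
  have h4 : (2 : ℝ)⁻¹ • (y + (x - y) + (y + -(x - y))) = y := by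
    rw [inv_smul_eq_iff₀ two_ne_zero, two_smul]; abel
  rw [h4] at h3
  rw [add_sub_cancel] at h1 h3
  rw [Real.dist_eq, abs_lt]
  constructor <;> linarith

theorem midconvex_continuous_iff_bddAbove_on_nonflat_continuum
    {n : ℕ} (hn : 0 < n) (D : Set (Fin n → ℝ))
    (hne : D.Nonempty) (hD : IsOpen D) (hDconv : Convex ℝ D)
    (f : (Fin n → ℝ) → ℝ)
    (hf : ∀ x ∈ D, ∀ y ∈ D, f ((2 : ℝ)⁻¹ • (x + y)) ≤ (f x + f y) / 2) :
    ContinuousOn f D ↔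
      ∃ K : Set (Fin n → ℝ), K.Nonempty ∧ IsCompact K ∧ IsConnected K ∧ K ⊆ D ∧
        affineSpan ℝ K = ⊤ ∧ BddAbove (f '' K) := by
  constructor
  · intro hcont
    obtain ⟨x, hx⟩ := hne
    obtain ⟨r, hr, hrD⟩ := Metric.nhds_basis_closedBall.mem_iff.1 (hD.mem_nhds hx)
    have hK : IsCompact (closedBall x r) := isCompact_closedBall x r
    have hxK : x ∈ closedBall x r := mem_closedBall_self hr.le
    refine ⟨closedBall x r, ⟨x, hxK⟩, hK, ⟨⟨x, hxK⟩, (convex_closedBall x r).isPreconnected⟩,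
      hrD, ?_, hK.bddAbove_image (hcont.mono hrD)⟩
    have := isOpen_ball.affineSpan_eq_top ⟨x, mem_ball_self (x := x) hr⟩
    exact top_unique (this ▸ affineSpan_mono ℝ ball_subset_closedBall)
  · rintro ⟨K, -, hK, hK', hKD, hspan, M, hM⟩
    have hmid : ∀ x ∈ D ∩ {x | f x ≤ M}, ∀ y ∈ D ∩ {x | f x ≤ M},
        (2 : ℝ)⁻¹ • (x + y) ∈ D ∩ {x | f x ≤ M} := by
      rintro x ⟨hx, hxM⟩ y ⟨hy, hyM⟩
      refine ⟨?_, (hf x hx y hy).trans ?_⟩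
      · rw [smul_add]
        exact hDconv hx hy (by norm_num) (by norm_num) (by norm_num)
      · rw [mem_ofPred_eq] at hxM hyM
        linarith
    have hKB : K ⊆ D ∩ {x | f x ≤ M} := fun x hx => ⟨hKD hx, hM (mem_image_of_mem f hx)⟩
    obtain ⟨U, hUB, hU, hUne⟩ := exists_isOpen_subset_of_midpoint_mem hK hK' hspan hKB hmid
    intro y hy
    have hbdd : BddAbove (f '' U) := ⟨M, by
      rintro _ ⟨x, hx, rfl⟩
      exact (hUB hx).2⟩
    obtain ⟨M', hM'⟩ := exists_eventually_le_of_midconvex hD hDconv hf hU hUne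
      (fun x hx => (hUB hx).1) hbdd hy
    exact (continuousAt_of_midconvex_of_bddAbove hD hf hy hM').continuousWithinAt
end
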